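/- Let M∈ℕ, R>0. There exist ε_0>0 and C>0 (depending on M,R) such that for all 0<ε≤ε_0 the following holds. Let f be a smooth global-in-time solution of (∂_t+∂_r+1/r)f = fμ + g whose initial data f|_{t=0} is supported in A_0^R and satisfies ‖f|_{t=0}‖_{C^M} ≤ ε, where μ,g are C^M functions with g supported in A^R and (1+r)²|Z^Iμ(t,x)|+(1+r)³|Z^Ig(t,x)| ≤ ε for all (t,x) and all multi-indices |I|≤M. Then for every product Ω^J of spatial rotations and every product Z^I of Minkowski vector fields with |I|+|J| ≤ M, one has |Ω^JZ^If(t,x)| ≤ Cε/(1+r) for all (t,x). -/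

import Mathlib

noncomputable section

open Real MeasureTheory

/-- Spatial points x ∈ ℝ³. -/
abbrev Spc := Fin 3 → ℝ

/-- Spacetime points (t, x) ∈ ℝ × ℝ³. -/
abbrev Pt := ℝ × Spc

/-- Euclidean radius r = |x|. -/
def rad (x : Spc) : ℝ := Real.sqrt (∑ i, x i ^ 2)

/-- Partial derivative in time, ∂_t. -/
def ptd (u : Pt → ℝ) (p : Pt) : ℝ := deriv (fun s => u (s, p.2)) p.1

/-- Partial derivative in the i-th spatial direction, ∂_i. -/
def pxd (i : Fin 3) (u : Pt → ℝ) (p : Pt) : ℝ :=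
  deriv (fun s => u (p.1, Function.update p.2 i s)) (p.2 i)

/-- Radial derivative ∂_r = ω^i ∂_i, with ω_i = x_i / r. -/
def prd (u : Pt → ℝ) (p : Pt) : ℝ := ∑ i, (p.2 i / rad p.2) * pxd i u p

/-- d'Alembertian □ = -∂_t² + Δ. -/
def box (u : Pt → ℝ) (p : Pt) : ℝ := - ptd (ptd u) p + ∑ i, pxd i (pxd i u) p

/-- Spacetime gradient ∂u = (∂_t u, ∂_1 u, ∂_2 u, ∂_3 u). -/
def sgrad (u : Pt → ℝ) (p : Pt) : Fin 4 → ℝ :=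
  ![ptd u p, pxd 0 u p, pxd 1 u p, pxd 2 u p]

/-- Good spatial derivative ∂̄_i = ∂_i - ω_i ∂_r. -/
def gb (i : Fin 3) (u : Pt → ℝ) (p : Pt) : ℝ :=
  pxd i u p - (p.2 i / rad p.2) * prd u p

/-- Good derivatives (∂̄_0, ∂̄_1, ∂̄_2, ∂̄_3), ∂̄_0 = (∂_t+∂_r)/2. -/
def gdrv (u : Pt → ℝ) (p : Pt) : Fin 4 → ℝ :=
  ![(ptd u p + prd u p) / 2, gb 0 u p, gb 1 u p, gb 2 u p]

/-- |∂u| = Σ_α |∂_α u|. -/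
def gradAbs (u : Pt → ℝ) (p : Pt) : ℝ := ∑ α, |sgrad u p α|

/-- |∂̄u| = Σ_α |∂̄_α u|. -/
def gdrvAbs (u : Pt → ℝ) (p : Pt) : ℝ := ∑ α, |gdrv u p α|

/-- Basic null form Q₀(X,Y) = -X₀Y₀ + δ^{ij}X_iY_j. -/
def Q0form (X Y : Fin 4 → ℝ) : ℝ := -(X 0 * Y 0) + X 1 * Y 1 + X 2 * Y 2 + X 3 * Y 3

/-- Basic null forms Q_{αβ}(X,Y) = X_αY_β - X_βY_α. -/
def Qform (a b : Fin 4) (X Y : Fin 4 → ℝ) : ℝ := X a * Y b - X b * Y a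

/-- A null form is a linear combination of Q₀ and the Q_{αβ}. -/
def IsNullForm (Q : (Fin 4 → ℝ) → (Fin 4 → ℝ) → ℝ) : Prop :=
  ∃ (c : ℝ) (d : Fin 4 → Fin 4 → ℝ), ∀ X Y,
    Q X Y = c * Q0form X Y + ∑ a, ∑ b, d a b * Qform a b X Y

/-- First-order operators acting on scalar functions on spacetime. -/
abbrev Op := (Pt → ℝ) → Pt → ℝ

/-- Scaling vector field S = t∂_t + r∂_r. -/
def vfS : Op := fun u p => p.1 * ptd u p + ∑ i, p.2 i * pxd i u p

/-- Rotations Ω_{ij} = x_i∂_j - x_j∂_i. -/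
def vfRot (i j : Fin 3) : Op := fun u p => p.2 i * pxd j u p - p.2 j * pxd i u p

/-- Lorentz boosts Ω_{0i} = -t∂_i - x_i∂_t. -/
def vfBoost (i : Fin 3) : Op := fun u p => -(p.1 * pxd i u p) - p.2 i * ptd u p

/-- The 11 Minkowski vector fields. -/
def mink : Fin 11 → Op :=
  ![ptd, pxd 0, pxd 1, pxd 2, vfS, vfBoost 0, vfBoost 1, vfBoost 2,
    vfRot 0 1, vfRot 0 2, vfRot 1 2]

/-- Application of a product Z^I of first-order operators, I given as a list. -/
def applyOps (L : List Op) (u : Pt → ℝ) : Pt → ℝ := L.foldr (fun Z v => Z v) u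

/-- A multi-index: a word in the Minkowski vector fields. -/
def IsMulti (L : List Op) : Prop := ∀ Z ∈ L, ∃ n : Fin 11, Z = mink n

/-- A word in the spatial rotations only. -/
def IsRotMulti (L : List Op) : Prop :=
  ∀ Z ∈ L, Z = vfRot 0 1 ∨ Z = vfRot 0 2 ∨ Z = vfRot 1 2

/-- The region A^R = {1/R ≤ r - t ≤ R}. -/
def regA (R : ℝ) : Set Pt := {p | 1 / R ≤ rad p.2 - p.1 ∧ rad p.2 - p.1 ≤ R}

/-- The region B^R = {r - t ≤ R}. -/
def regB (R : ℝ) : Set Pt := {p | rad p.2 - p.1 ≤ R}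

/-- The region A₀^R = A^R ∩ {t = 0}. -/
def regA0 (R : ℝ) : Set Spc := {x | 1 / R ≤ rad x ∧ rad x ≤ R}

/-- L² norm of a function on a spatial slice. -/
def L2 (f : Spc → ℝ) : ℝ := (∫ x : Spc, (f x) ^ 2) ^ (1/2 : ℝ)

/-- Weighted Sobolev norm ‖u‖_{H^m_δ} = Σ_{k≤m} ‖⟨x⟩^{δ+k} ∇^k u‖_{L²}. -/
def sobNorm (m : ℕ) (δ : ℝ) (u : Spc → ℝ) : ℝ :=
  ∑ k ∈ Finset.range (m + 1),
    (∫ x : Spc, ((1 + ∑ i, x i ^ 2) ^ ((δ + k) / 2) * ‖iteratedFDeriv ℝ k u x‖) ^ 2) ^ (1/2 : ℝ)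

/-- Membership in the weighted Sobolev space H^m_δ (finiteness of the norm). -/
def MemSob (m : ℕ) (δ : ℝ) (u : Spc → ℝ) : Prop :=
  ∀ k ≤ m, Integrable (fun x : Spc =>
    ((1 + ∑ i, x i ^ 2) ^ ((δ + k) / 2) * ‖iteratedFDeriv ℝ k u x‖) ^ 2)

/-- ‖f‖_{C^M} ≤ ε, stated derivative by derivative. -/
def CMBound (M : ℕ) (f : Spc → ℝ) (ε : ℝ) : Prop :=
  ∀ k ≤ M, ∀ x, ‖iteratedFDeriv ℝ k f x‖ ≤ ε

/-- The transport operator 𝓛 = ∂_t + ∂_r + 1/r. -/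
def opLb : Op := fun u p => ptd u p + prd u p + u p / rad p.2

/-- The spacetime gradient of u = t - r, namely (1, -ω₁, -ω₂, -ω₃). -/
def duTmR (p : Pt) : Fin 4 → ℝ :=
  ![1, -(p.2 0 / rad p.2), -(p.2 1 / rad p.2), -(p.2 2 / rad p.2)]

/-- Oscillating profiles T_λ^{(k,i)}. -/
def Ttrig (lam : ℝ) (k i : ℤ) (p : Pt) : ℝ :=
  if (k + i) % 2 = 0 then Real.cos (i * (p.1 - rad p.2) / lam)
  else Real.sin (i * (p.1 - rad p.2) / lam)

/-! ### Part 1: words in vector fields -/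

/-- Derivative along a vector field. -/
def dd (V : Pt → Pt) (u : Pt → ℝ) (p : Pt) : ℝ := fderiv ℝ u p (V p)

/-- Words in a family of vector fields; the head of the list acts first. -/
def dw {ι : Type} (V : ι → Pt → Pt) : List ι → (Pt → ℝ) → Pt → ℝ
  | [], u => u
  | i :: w, u => dw V w (dd (V i) u)

/-- Smoothness on a set, order by order. -/
def SmOn {X : Type*} [NormedAddCommGroup X] [NormedSpace ℝ X] (u : Pt → X) (U : Set Pt) : Prop :=
  ∀ n : ℕ, ContDiffOn ℝ n u U

lemma dd_cd {U : Set Pt} (hU : IsOpen U) {n : ℕ} {u : Pt → ℝ} {V : Pt → Pt}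
    (hu : ContDiffOn ℝ (n + 1 : ℕ) u U) (hV : SmOn V U) : ContDiffOn ℝ n (dd V u) U := by
  have h := hu.fderiv_of_isOpen (m := n) hU (by norm_cast)
  exact h.clm_apply (hV n)

lemma cd_le {U : Set Pt} {m n : ℕ} (h : m ≤ n) {u : Pt → ℝ}
    (hu : ContDiffOn ℝ n u U) : ContDiffOn ℝ m u U :=
  hu.of_le (by exact_mod_cast h)

lemma dw_cd {ι : Type} {U : Set Pt} (hU : IsOpen U) {V : ι → Pt → Pt} (hV : ∀ i, SmOn (V i) U)
    (w : List ι) : ∀ {n : ℕ} {u : Pt → ℝ}, ContDiffOn ℝ (n + w.length : ℕ) u U →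
    ContDiffOn ℝ n (dw V w u) U := by
  induction w with
  | nil => intro n u hu; simpa [dw] using hu
  | cons i w ih =>
    intro n u hu
    exact ih (dd_cd hU (by simpa [add_assoc] using hu) (hV i))

lemma dw_sm {ι : Type} {U : Set Pt} (hU : IsOpen U) {V : ι → Pt → Pt} (hV : ∀ i, SmOn (V i) U)
    (w : List ι) {u : Pt → ℝ} (hu : SmOn u U) : SmOn (dw V w u) U :=
  fun n => dw_cd hU hV w (hu _)

lemma dd_sm {U : Set Pt} (hU : IsOpen U) {V : Pt → Pt} (hV : SmOn V U)
    {u : Pt → ℝ} (hu : SmOn u U) : SmOn (dd V u) U :=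
  fun n => dd_cd hU (hu _) hV

lemma dd_congr {U : Set Pt} (hU : IsOpen U) {V : Pt → Pt} {u v : Pt → ℝ}
    (h : Set.EqOn u v U) : Set.EqOn (dd V u) (dd V v) U := by
  intro p hp
  have : u =ᶠ[nhds p] v := Filter.eventuallyEq_of_mem (hU.mem_nhds hp) h
  simp only [dd, this.fderiv_eq]

lemma dw_congr {ι : Type} {U : Set Pt} (hU : IsOpen U) {V : ι → Pt → Pt} (w : List ι) :
    ∀ {u v : Pt → ℝ}, Set.EqOn u v U → Set.EqOn (dw V w u) (dw V w v) U := by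
  induction w with
  | nil => intro u v h; exact h
  | cons i w ih => intro u v h; exact ih (dd_congr hU h)

lemma dw_append {ι : Type} (V : ι → Pt → Pt) (w w' : List ι) :
    ∀ u : Pt → ℝ, dw V (w ++ w') u = dw V w' (dw V w u) := by
  induction w with
  | nil => intro u; rfl
  | cons i w ih => intro u; exact ih _

lemma cd_diff {U : Set Pt} (hU : IsOpen U) {n : ℕ} {u : Pt → ℝ}
    (hu : ContDiffOn ℝ (n + 1 : ℕ) u U) {p : Pt} (hp : p ∈ U) : DifferentiableAt ℝ u p :=
  (hu.contDiffAt (hU.mem_nhds hp)).differentiableAt (by norm_cast)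

lemma sm_diff {U : Set Pt} (hU : IsOpen U) {u : Pt → ℝ}
    (hu : SmOn u U) {p : Pt} (hp : p ∈ U) : DifferentiableAt ℝ u p :=
  cd_diff hU (n := 0) (hu _) hp

lemma dd_add {V : Pt → Pt} {u v : Pt → ℝ} {p : Pt} (hu : DifferentiableAt ℝ u p)
    (hv : DifferentiableAt ℝ v p) : dd V (fun q => u q + v q) p = dd V u p + dd V v p := by
  simp only [dd]; rw [fderiv_fun_add hu hv]; rfl

lemma dd_mul {V : Pt → Pt} {u v : Pt → ℝ} {p : Pt} (hu : DifferentiableAt ℝ u p)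
    (hv : DifferentiableAt ℝ v p) :
    dd V (fun q => u q * v q) p = dd V u p * v p + u p * dd V v p := by
  simp only [dd]; rw [fderiv_fun_mul hu hv]; simp; ring

lemma dw_zero {ι : Type} (V : ι → Pt → Pt) (w : List ι) : dw V w (fun _ => 0) = fun _ => 0 := by
  induction w with
  | nil => rfl
  | cons i w ih =>
    have : dd (V i) (fun _ => (0:ℝ)) = fun _ => 0 := by funext p; simp [dd]
    simp only [dw, this, ih]

lemma dw_add {ι : Type} {U : Set Pt} (hU : IsOpen U) {V : ι → Pt → Pt} (hV : ∀ i, SmOn (V i) U)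
    (w : List ι) : ∀ {u v : Pt → ℝ}, ContDiffOn ℝ (w.length : ℕ) u U →
    ContDiffOn ℝ (w.length : ℕ) v U →
    Set.EqOn (dw V w (fun q => u q + v q)) (fun q => dw V w u q + dw V w v q) U := by
  induction w with
  | nil => intro u v _ _ p _; rfl
  | cons i w ih =>
    intro u v hu hv p hp
    have h1 : Set.EqOn (dd (V i) (fun q => u q + v q)) (fun q => dd (V i) u q + dd (V i) v q) U :=
      fun q hq => dd_add (cd_diff hU hu hq) (cd_diff hU hv hq)
    have := dw_congr hU (V := V) w h1 hp
    simp only [dw]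
    rw [this]
    exact ih (dd_cd hU hu (hV i)) (dd_cd hU hv (hV i)) hp

lemma dw_sum {ι κ : Type} {U : Set Pt} (hU : IsOpen U) {V : ι → Pt → Pt}
    (hV : ∀ i, SmOn (V i) U)
    (w : List ι) (s : Finset κ) {u : κ → Pt → ℝ} (hu : ∀ k, ContDiffOn ℝ (w.length : ℕ) (u k) U) :
    Set.EqOn (dw V w (fun q => ∑ k ∈ s, u k q)) (fun q => ∑ k ∈ s, dw V w (u k) q) U := by
  classical
  induction s using Finset.induction_on with
  | empty => intro p _; simp [dw_zero]
  | insert a s ha ih =>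
    intro p hp
    simp only [Finset.sum_insert ha]
    rw [dw_add hU hV w (hu a) (ContDiffOn.sum fun k _ => hu k) hp]
    simp only
    rw [ih hp]

lemma dw_mul_bound {ι : Type} {U : Set Pt} (hU : IsOpen U) {V : ι → Pt → Pt}
    (hV : ∀ i, SmOn (V i) U) {p : Pt} (hp : p ∈ U) (n : ℕ) :
    ∀ (w : List ι), w.length ≤ n → ∀ {a b : Pt → ℝ} {A B : ℝ}, ContDiffOn ℝ n a U →
    ContDiffOn ℝ n b U → (∀ v : List ι, v.length ≤ n → |dw V v a p| ≤ A) →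
    (∀ v : List ι, v.length ≤ n → |dw V v b p| ≤ B) →
    |dw V w (fun q => a q * b q) p| ≤ 2 ^ n * (A * B) := by
  induction n with
  | zero =>
    intro w hw a b A B ha hb hA hB
    obtain rfl : w = [] := List.length_eq_zero_iff.mp (by omega)
    have h1 := hA [] (by simp)
    have h2 := hB [] (by simp)
    simp only [dw] at h1 h2 ⊢
    rw [abs_mul, pow_zero, one_mul]
    exact mul_le_mul h1 h2 (abs_nonneg _) ((abs_nonneg _).trans h1)
  | succ n ih =>
    intro w hw a b A B ha hb hA hB
    have hA0 : 0 ≤ A := (abs_nonneg _).trans (hA [] (by simp))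
    have hB0 : 0 ≤ B := (abs_nonneg _).trans (hB [] (by simp))
    cases w with
    | nil =>
      have h1 := hA [] (by simp)
      have h2 := hB [] (by simp)
      simp only [dw] at h1 h2 ⊢
      rw [abs_mul]
      calc |a p| * |b p| ≤ A * B := mul_le_mul h1 h2 (abs_nonneg _) hA0
        _ ≤ 2 ^ (n+1) * (A * B) :=
          le_mul_of_one_le_left (by positivity) (one_le_pow₀ (by norm_num))
    | cons i w =>
      have hw' : w.length ≤ n := by simpa using hw
      have h1 : Set.EqOn (dd (V i) (fun q => a q * b q))
          (fun q => dd (V i) a q * b q + a q * dd (V i) b q) U :=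
        fun q hq => dd_mul (cd_diff hU ha hq) (cd_diff hU hb hq)
      have h2 := dw_congr hU (V := V) w h1 hp
      have ha' := dd_cd hU ha (hV i)
      have hb' := dd_cd hU hb (hV i)
      have ha0 := cd_le (Nat.le_succ n) ha
      have hb0 := cd_le (Nat.le_succ n) hb
      have h3 := dw_add hU hV w (cd_le hw' (ha'.mul hb0)) (cd_le hw' (ha0.mul hb')) hp
      simp only [dw]
      rw [h2, h3]
      have e1 := ih w hw' ha' hb0 (A := A) (B := B)
        (fun v hv => hA (i :: v) (by simpa using hv)) (fun v hv => hB v (by omega))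
      have e2 := ih w hw' ha0 hb' (A := A) (B := B)
        (fun v hv => hA v (by omega)) (fun v hv => hB (i :: v) (by simpa using hv))
      calc _ ≤ _ := abs_add_le _ _
        _ ≤ 2 ^ n * (A * B) + 2 ^ n * (A * B) := add_le_add e1 e2
        _ = _ := by ring

lemma words_finite (ι : Type) [Finite ι] (n : ℕ) : {w : List ι | w.length ≤ n}.Finite :=
  List.finite_length_le ι n

/-- Change of frame: words in `A` are bounded by words in `B` if `A = c B` with `c` bounded. -/
lemma conv {ι κ : Type} [Finite ι] [Fintype κ] {U P : Set Pt} (hU : IsOpen U) (hPU : P ⊆ U)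
    {A : ι → Pt → Pt} {B : κ → Pt → Pt} {c : ι → κ → Pt → ℝ}
    (hA : ∀ i, SmOn (A i) U) (hB : ∀ i, SmOn (B i) U) (hcs : ∀ i j, SmOn (c i j) U)
    (hAB : ∀ i, ∀ p ∈ U, A i p = ∑ j, c i j p • B j p)
    (hc : ∀ i j, ∀ w : List κ, ∃ K, ∀ p ∈ P, |dw B w (c i j) p| ≤ K) (n : ℕ) :
    ∃ K, 0 < K ∧ ∀ u : Pt → ℝ, ContDiffOn ℝ n u U → ∀ p ∈ P, ∀ Bd : ℝ,
      (∀ v : List κ, v.length ≤ n → |dw B v u p| ≤ Bd) →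
      ∀ w : List ι, w.length ≤ n → |dw A w u p| ≤ K * Bd := by
  induction n with
  | zero =>
    refine ⟨1, one_pos, ?_⟩
    intro u hu p hp Bd hBd w hw
    obtain rfl : w = [] := List.length_eq_zero_iff.mp (by omega)
    simpa [dw] using hBd [] (by simp)
  | succ n ih =>
    obtain ⟨K, hK, ih⟩ := ih
    choose k hk using hc
    have hfin := (Set.finite_univ (α := ι)).prod
      ((Set.finite_univ (α := κ)).prod (words_finite κ n))
    obtain ⟨Kc, hKc⟩ := (hfin.image (fun x => k x.1 x.2.1 x.2.2)).bddAbove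
    have hKc' : ∀ i j w, w.length ≤ n → ∀ p ∈ P, |dw B w (c i j) p| ≤ max Kc 0 := by
      intro i j w hw p hp
      refine (hk i j w p hp).trans (le_trans ?_ (le_max_left _ _))
      exact hKc ⟨(i, j, w), ⟨trivial, trivial, hw⟩, rfl⟩
    refine ⟨1 + K * (Fintype.card κ * (2 ^ n * max Kc 0)), by positivity, ?_⟩
    intro u hu p hp Bd hBd w hw
    have hB0 : 0 ≤ Bd := (abs_nonneg _).trans (hBd [] (by simp))
    cases w with
    | nil =>
      have := hBd [] (by simp)
      simp only [dw] at this ⊢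
      refine this.trans (le_mul_of_one_le_left hB0 ?_)
      have : 0 ≤ K * (Fintype.card κ * (2 ^ n * max Kc 0)) := by positivity
      linarith
    | cons i w =>
      have hw' : w.length ≤ n := by simpa using hw
      have key := ih (dd (A i) u) (dd_cd hU hu (hA i)) p hp
        (Fintype.card κ * (2 ^ n * (max Kc 0 * Bd))) ?_ w hw'
      · simp only [dw]
        refine key.trans ?_
        nlinarith
      · intro v hv
        have h1 : Set.EqOn (dd (A i) u) (fun q => ∑ j, c i j q * dd (B j) u q) U := by
          intro q hq
          simp only [dd]
          rw [hAB i q hq, map_sum]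
          simp
        have hcd : ∀ j, ContDiffOn ℝ n (fun q => c i j q * dd (B j) u q) U := fun j =>
          (hcs i j n).mul (dd_cd hU hu (hB j))
        rw [dw_congr hU v h1 (hPU hp),
          dw_sum hU hB v Finset.univ (fun j => cd_le hv (hcd j)) (hPU hp)]
        refine (Finset.abs_sum_le_sum_abs _ _).trans ?_
        refine (Finset.sum_le_card_nsmul _ _ (2 ^ n * (max Kc 0 * Bd)) ?_).trans ?_
        · intro j _
          exact dw_mul_bound hU hB (hPU hp) n v hv (hcs i j n) (dd_cd hU hu (hB j))
            (fun v hv => hKc' i j v hv p hp) (fun v hv => hBd (j :: v) (by simpa using hv))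
        · simp

/-! ### Part 2: frames and coefficients -/

/-- The open set `x ≠ 0`. -/
def U0 : Set Pt := {p | p.2 ≠ 0}

lemma U0_open : IsOpen U0 := isOpen_ne_fun continuous_snd continuous_const

/-- `r` as a function on spacetime. -/
def rr (p : Pt) : ℝ := rad p.2
/-- `1/r`. -/
def ri (p : Pt) : ℝ := (rr p)⁻¹
/-- `x_i / r`. -/
def om (i : Fin 3) (p : Pt) : ℝ := p.2 i * ri p
/-- `r - t`. -/
def ss (p : Pt) : ℝ := rr p - p.1

lemma rad_sq (x : Spc) : rad x * rad x = ∑ i, x i * x i := by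
  rw [rad, Real.mul_self_sqrt (Finset.sum_nonneg fun i _ => sq_nonneg _)]
  simp [pow_two]

lemma rad_nonneg (x : Spc) : 0 ≤ rad x := Real.sqrt_nonneg _

lemma sumsq_pos {x : Spc} (hx : x ≠ 0) : 0 < ∑ i, x i ^ 2 := by
  obtain ⟨i, hi⟩ := Function.ne_iff.mp hx
  exact Finset.sum_pos' (fun i _ => sq_nonneg _) ⟨i, Finset.mem_univ _, by
    have : x i ≠ 0 := hi
    positivity⟩

lemma rad_pos {x : Spc} (hx : x ≠ 0) : 0 < rad x := Real.sqrt_pos.mpr (sumsq_pos hx)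

lemma rad_zero : rad 0 = 0 := by simp [rad]

lemma rr_pos {p : Pt} (hp : p ∈ U0) : 0 < rr p := rad_pos hp

lemma rr_ri {p : Pt} (hp : p ∈ U0) : rr p * ri p = 1 := mul_inv_cancel₀ (rr_pos hp).ne'

lemma x_eq {p : Pt} (hp : p ∈ U0) (i : Fin 3) : p.2 i = rr p * om i p := by
  have := rr_ri hp
  simp only [om]
  linear_combination (-p.2 i) * this

lemma om_sq {p : Pt} (hp : p ∈ U0) : om 0 p * om 0 p + om 1 p * om 1 p + om 2 p * om 2 p = 1 := by
  have h := rr_ri hp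
  have h2 := rad_sq p.2
  simp only [Fin.sum_univ_three] at h2
  have h3 : rr p * rr p = rad p.2 * rad p.2 := rfl
  simp only [om]
  linear_combination (-ri p ^ 2) * h2 - ri p ^ 2 * h3 + (rr p * ri p + 1) * h

lemma coord_sm (i : Fin 3) : ContDiff ℝ ⊤ (fun p : Pt => p.2 i) := by fun_prop

lemma rr_sm : SmOn rr U0 := by
  intro n p hp
  apply ContDiffAt.contDiffWithinAt
  unfold rr rad
  refine ContDiffAt.sqrt ?_ (sumsq_pos hp).ne'
  fun_prop

lemma ri_sm : SmOn ri U0 := fun n => (rr_sm n).inv fun p hp => (rr_pos hp).ne'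

lemma om_sm (i : Fin 3) : SmOn (om i) U0 := fun n =>
  ((coord_sm i).of_le le_top).contDiffOn.mul (ri_sm n)

lemma ss_sm : SmOn ss U0 := fun n => (rr_sm n).sub (by fun_prop)

lemma sm_of_comps {V : Pt → Pt} {U : Set Pt} (h0 : SmOn (fun p => (V p).1) U)
    (h : ∀ i, SmOn (fun p => (V p).2 i) U) : SmOn V U := fun n =>
  (h0 n).prodMk (contDiffOn_pi.mpr fun i => h i n)

/-- The radial field `∂_r`. -/
def Vr (p : Pt) : Pt := (0, fun i => om i p)
/-- The outgoing field `∂_t + ∂_r`. -/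
def VD (p : Pt) : Pt := (1, fun i => om i p)
/-- The field `r (∂_t + ∂_r)`. -/
def VX (p : Pt) : Pt := (rr p, p.2)
/-- Unit vectors. -/
def ev (i : Fin 3) : Spc := fun k => if k = i then 1 else 0
/-- Rotation fields. -/
def Rt (i j : Fin 3) (p : Pt) : Pt := (0, fun k => p.2 i * ev j k - p.2 j * ev i k)
/-- Boost fields. -/
def Bt (i : Fin 3) (p : Pt) : Pt := (-(p.2 i), fun k => -(p.1 * ev i k))

/-- Fields commuting with `∂_t + ∂_r`, tangent to the slices. -/
def fY : Fin 4 → Pt → Pt := ![Vr, Rt 0 1, Rt 0 2, Rt 1 2]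
/-- Frame used for the estimates. -/
def fE : Option (Fin 4) → Pt → Pt
  | none => VX
  | some i => fY i
/-- The Minkowski fields. -/
def fZ : Fin 11 → Pt → Pt :=
  ![fun _ => (1, 0), fun _ => (0, ev 0), fun _ => (0, ev 1), fun _ => (0, ev 2), fun p => p,
    Bt 0, Bt 1, Bt 2, Rt 0 1, Rt 0 2, Rt 1 2]
/-- The spatial coordinate fields. -/
def fP (i : Fin 3) : Pt → Pt := fun _ => (0, ev i)

lemma Vr_sm : SmOn Vr U0 := sm_of_comps (fun n => contDiffOn_const) (fun i => om_sm i)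
lemma VD_sm : SmOn VD U0 := sm_of_comps (fun n => contDiffOn_const) (fun i => om_sm i)
lemma VX_sm : SmOn VX U0 := fun n => (rr_sm n).prodMk contDiff_snd.contDiffOn
lemma Rt_sm (i j : Fin 3) (U : Set Pt) : SmOn (Rt i j) U := by
  intro n; unfold Rt; apply ContDiff.contDiffOn; fun_prop
lemma Bt_sm (i : Fin 3) (U : Set Pt) : SmOn (Bt i) U := by
  intro n; unfold Bt; apply ContDiff.contDiffOn; fun_prop
lemma fY_sm (i) : SmOn (fY i) U0 := by
  fin_cases i
  exacts [Vr_sm, Rt_sm _ _ _, Rt_sm _ _ _, Rt_sm _ _ _]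
lemma fE_sm (i) : SmOn (fE i) U0 := by
  cases i
  exacts [VX_sm, fY_sm _]
lemma fZ_sm (U : Set Pt) (i) : SmOn (fZ i) U := by
  fin_cases i
  exacts [fun n => contDiffOn_const, fun n => contDiffOn_const, fun n => contDiffOn_const,
    fun n => contDiffOn_const, fun n => contDiffOn_id, Bt_sm _ _, Bt_sm _ _, Bt_sm _ _,
    Rt_sm _ _ _, Rt_sm _ _ _, Rt_sm _ _ _]
lemma fP_sm (U : Set Pt) (i) : SmOn (fP i) U := fun n => contDiffOn_const

lemma dd_coord (V : Pt → Pt) (i : Fin 3) (p : Pt) : dd V (fun q => q.2 i) p = (V p).2 i := by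
  have h : HasFDerivAt (fun q : Pt => q.2 i)
    ((ContinuousLinearMap.proj (R := ℝ) (φ := fun _ : Fin 3 => ℝ) i).comp
      (ContinuousLinearMap.snd ℝ ℝ Spc)) p :=
    ((ContinuousLinearMap.proj (R := ℝ) (φ := fun _ : Fin 3 => ℝ) i).comp
      (ContinuousLinearMap.snd ℝ ℝ Spc)).hasFDerivAt
  simp [dd, h.fderiv]

lemma dd_time (V : Pt → Pt) (p : Pt) : dd V (fun q => q.1) p = (V p).1 := by
  have h : HasFDerivAt (fun q : Pt => q.1) (ContinuousLinearMap.fst ℝ ℝ Spc) p :=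
    (ContinuousLinearMap.fst ℝ ℝ Spc).hasFDerivAt
  simp [dd, h.fderiv]

lemma dd_const (V : Pt → Pt) (a : ℝ) (p : Pt) : dd V (fun _ => a) p = 0 := by simp [dd]

lemma dd_rr (V : Pt → Pt) {p : Pt} (hp : p ∈ U0) :
    dd V rr p = om 0 p * (V p).2 0 + om 1 p * (V p).2 1 + om 2 p * (V p).2 2 := by
  have hd := sm_diff U0_open rr_sm hp
  have h1 : (fun q => rr q * rr q) = fun q : Pt => q.2 0 * q.2 0 + q.2 1 * q.2 1 + q.2 2 * q.2 2 := by
    funext q; have := rad_sq q.2; simpa [Fin.sum_univ_three, rr] using this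
  have h2 := dd_mul (V := V) hd hd
  have hx : ∀ i, DifferentiableAt ℝ (fun q : Pt => q.2 i) p := fun i => by fun_prop
  rw [h1, dd_add (by fun_prop) (by fun_prop), dd_add (by fun_prop) (by fun_prop),
    dd_mul (hx 0) (hx 0), dd_mul (hx 1) (hx 1), dd_mul (hx 2) (hx 2)] at h2
  simp only [dd_coord] at h2
  have h3 := rr_ri hp
  simp only [om]
  linear_combination (-ri p/2) * h2 - dd V rr p * h3

lemma dd_ri (V : Pt → Pt) {p : Pt} (hp : p ∈ U0) :
    dd V ri p = - (ri p * ri p * dd V rr p) := by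
  have h2 := dd_mul (V := V) (sm_diff U0_open rr_sm hp) (sm_diff U0_open ri_sm hp)
  have h1 : Set.EqOn (fun q => rr q * ri q) (fun _ => 1) U0 := fun q hq => rr_ri hq
  rw [dd_congr U0_open h1 hp, dd_const] at h2
  have h3 := rr_ri hp
  linear_combination (-ri p) * h2 - dd V ri p * h3

lemma dd_om (V : Pt → Pt) (i : Fin 3) {p : Pt} (hp : p ∈ U0) :
    dd V (om i) p = ri p * ((V p).2 i - om i p * dd V rr p) := by
  have h2 := dd_mul (V := V) (u := fun q => q.2 i) (by fun_prop) (sm_diff U0_open ri_sm hp)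
  rw [dd_coord, dd_ri V hp] at h2
  simp only [om]
  refine h2.trans ?_
  ring

lemma dd_ss (V : Pt → Pt) {p : Pt} (hp : p ∈ U0) : dd V ss p = dd V rr p - (V p).1 := by
  have : ss = fun q => rr q + (-1) * q.1 := by funext q; simp [ss]; ring
  rw [this, dd_add (sm_diff U0_open rr_sm hp) (by fun_prop),
    dd_mul (by fun_prop) (by fun_prop), dd_const, dd_time]
  ring

/-- Symbols: `Coef k c` means that `c` is of size `r ^ k`, with all its derivatives. -/
inductive Coef : ℤ → (Pt → ℝ) → Prop
  | g_const (a : ℝ) : Coef 0 (fun _ => a)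
  | g_om (i : Fin 3) : Coef 0 (om i)
  | g_ss : Coef 0 ss
  | g_rr : Coef 1 rr
  | g_ri : Coef (-1) ri
  | mul {k l : ℤ} {a b : Pt → ℝ} : Coef k a → Coef l b → Coef (k + l) (fun q => a q * b q)
  | add {k : ℤ} {a b : Pt → ℝ} : Coef k a → Coef k b → Coef k (fun q => a q + b q)
  | weaken {k : ℤ} {a : Pt → ℝ} : Coef k a → Coef (k + 1) a
  | congr {k : ℤ} {a b : Pt → ℝ} : Coef k a → Set.EqOn b a U0 → Coef k b

lemma Coef.sm {k : ℤ} {c : Pt → ℝ} (h : Coef k c) : SmOn c U0 := by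
  induction h with
  | g_const a => exact fun n => contDiffOn_const
  | g_om i => exact om_sm i
  | g_ss => exact ss_sm
  | g_rr => exact rr_sm
  | g_ri => exact ri_sm
  | mul _ _ h1 h2 => exact fun n => (h1 n).mul (h2 n)
  | add _ _ h1 h2 => exact fun n => (h1 n).add (h2 n)
  | weaken _ h => exact h
  | congr _ h1 h => exact fun n => (h n).congr h1

lemma Coef.mul0 {k : ℤ} {a b : Pt → ℝ} (ha : Coef 0 a) (hb : Coef k b) :
    Coef k (fun q => a q * b q) := by
  have := Coef.mul ha hb
  rwa [zero_add] at this

lemma Coef.neg {k : ℤ} {a : Pt → ℝ} (ha : Coef k a) : Coef k (fun q => - a q) :=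
  (Coef.mul0 (Coef.g_const (-1)) ha).congr fun q _ => by simp

lemma Coef.sub {k : ℤ} {a b : Pt → ℝ} (ha : Coef k a) (hb : Coef k b) :
    Coef k (fun q => a q - b q) :=
  (Coef.add ha hb.neg).congr fun q _ => by simp; ring

lemma Coef.ri0 : Coef 0 ri := Coef.weaken Coef.g_ri

lemma Coef.zero {k : ℤ} {a : Pt → ℝ} (ha : Coef k a) : Coef k (fun _ => 0) :=
  (Coef.mul0 (Coef.g_const 0) ha).congr fun q _ => by simp

lemma rr_VX {p : Pt} (hp : p ∈ U0) : dd VX rr p = rr p := by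
  rw [dd_rr _ hp]
  simp only [VX, x_eq hp]
  linear_combination rr p * om_sq hp

lemma rr_Vr {p : Pt} (hp : p ∈ U0) : dd Vr rr p = 1 := by
  rw [dd_rr _ hp]
  simp only [Vr]
  linear_combination om_sq hp

lemma rr_VD {p : Pt} (hp : p ∈ U0) : dd VD rr p = 1 := by
  rw [dd_rr _ hp]
  simp only [VD]
  linear_combination om_sq hp

lemma rr_Rt (i j : Fin 3) {p : Pt} (hp : p ∈ U0) : dd (Rt i j) rr p = 0 := by
  rw [dd_rr _ hp]
  simp only [Rt, x_eq hp]
  fin_cases i <;> fin_cases j <;> simp [ev] <;> ring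

lemma Rt_coord (i j : Fin 3) {p : Pt} (hp : p ∈ U0) (k : Fin 3) :
    ri p * (Rt i j p).2 k = om i p * ev j k - om j p * ev i k := by
  have := rr_ri hp
  simp only [Rt, om]
  ring

lemma fY_rot {i : Fin 4} : fY i = Vr ∨ ∃ a b, fY i = Rt a b := by
  fin_cases i
  · exact Or.inl rfl
  · exact Or.inr ⟨0, 1, rfl⟩
  · exact Or.inr ⟨0, 2, rfl⟩
  · exact Or.inr ⟨1, 2, rfl⟩

lemma Coef.dE {k : ℤ} {c : Pt → ℝ} (h : Coef k c) (j : Option (Fin 4)) :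
    Coef k (dd (fE j) c) := by
  have hj : fE j = VX ∨ fE j = Vr ∨ ∃ a b, fE j = Rt a b := by
    cases j with
    | none => exact Or.inl rfl
    | some j => exact Or.inr fY_rot
  induction h with
  | g_const a => exact (Coef.g_const 0).congr fun q _ => dd_const _ _ _
  | g_om i =>
    rcases hj with hj | hj | ⟨a, b, hj⟩ <;> rw [hj]
    · refine (Coef.g_const 0).congr fun q hq => ?_
      rw [dd_om _ _ hq, rr_VX hq]
      simp only [VX, x_eq hq]; ring
    · refine (Coef.g_const 0).congr fun q hq => ?_
      rw [dd_om _ _ hq, rr_Vr hq]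
      simp only [Vr]; ring
    · refine (((Coef.g_om a).mul0 (Coef.g_const (ev b i))).sub
        ((Coef.g_om b).mul0 (Coef.g_const (ev a i)))).congr fun q hq => ?_
      rw [dd_om _ _ hq, rr_Rt _ _ hq]
      simp only [mul_zero, sub_zero]
      exact Rt_coord a b hq i
  | g_ss =>
    rcases hj with hj | hj | ⟨a, b, hj⟩ <;> rw [hj]
    · refine (Coef.g_const 0).congr fun q hq => ?_
      rw [dd_ss _ hq, rr_VX hq]; simp [VX]
    · refine (Coef.g_const 1).congr fun q hq => ?_
      rw [dd_ss _ hq, rr_Vr hq]; simp [Vr]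
    · refine (Coef.g_const 0).congr fun q hq => ?_
      rw [dd_ss _ hq, rr_Rt _ _ hq]; simp [Rt]
  | g_rr =>
    rcases hj with hj | hj | ⟨a, b, hj⟩ <;> rw [hj]
    · exact Coef.g_rr.congr fun q hq => rr_VX hq
    · exact (Coef.g_const 1).weaken.congr fun q hq => rr_Vr hq
    · exact (Coef.g_const 0).weaken.congr fun q hq => rr_Rt _ _ hq
  | g_ri =>
    rcases hj with hj | hj | ⟨a, b, hj⟩ <;> rw [hj]
    · refine Coef.g_ri.neg.congr fun q hq => ?_
      rw [dd_ri _ hq, rr_VX hq]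
      linear_combination (- ri q) * rr_ri hq
    · refine (Coef.mul0 Coef.ri0 Coef.g_ri).neg.congr fun q hq => ?_
      rw [dd_ri _ hq, rr_Vr hq]; ring
    · refine Coef.g_ri.zero.congr fun q hq => ?_
      rw [dd_ri _ hq, rr_Rt _ _ hq]; ring
  | mul ha hb h1 h2 =>
    refine (Coef.add (Coef.mul h1 hb) (Coef.mul ha h2)).congr fun q hq => ?_
    exact dd_mul (sm_diff U0_open ha.sm hq) (sm_diff U0_open hb.sm hq)
  | add ha hb h1 h2 =>
    refine (Coef.add h1 h2).congr fun q hq => ?_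
    exact dd_add (sm_diff U0_open ha.sm hq) (sm_diff U0_open hb.sm hq)
  | weaken _ h => exact h.weaken
  | congr _ h1 h => exact h.congr (dd_congr U0_open h1)

/-- A row of coefficients. -/
def row (a b c d e : Pt → ℝ) : Option (Fin 4) → Pt → ℝ
  | none => a
  | some i => (![b, c, d, e] : Fin 4 → Pt → ℝ) i

lemma row_coef {k : ℤ} {a b c d e : Pt → ℝ} (ha : Coef k a) (hb : Coef k b) (hc : Coef k c)
    (hd : Coef k d) (he : Coef k e) (j) : Coef k (row a b c d e j) := by
  cases j with
  | none => exact ha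
  | some j =>
    fin_cases j
    exacts [hb, hc, hd, he]

/-- `1 - (r-t)/r = t/r`. -/
def tr (q : Pt) : ℝ := 1 - ss q * ri q

lemma tr_coef : Coef 0 tr := (Coef.g_const 1).sub (Coef.g_ss.mul0 Coef.ri0)

/-- Minkowski fields in terms of the frame. -/
def cZE : Fin 11 → Option (Fin 4) → Pt → ℝ :=
  ![row ri (fun _ => -1) (fun _ => 0) (fun _ => 0) (fun _ => 0),
    row (fun _ => 0) (om 0) (fun q => -(ri q * om 1 q)) (fun q => -(ri q * om 2 q)) (fun _ => 0),
    row (fun _ => 0) (om 1) (fun q => ri q * om 0 q) (fun _ => 0) (fun q => -(ri q * om 2 q)),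
    row (fun _ => 0) (om 2) (fun _ => 0) (fun q => ri q * om 0 q) (fun q => ri q * om 1 q),
    row tr ss (fun _ => 0) (fun _ => 0) (fun _ => 0),
    row (fun q => -om 0 q) (fun q => ss q * om 0 q) (fun q => tr q * om 1 q)
      (fun q => tr q * om 2 q) (fun _ => 0),
    row (fun q => -om 1 q) (fun q => ss q * om 1 q) (fun q => -(tr q * om 0 q))
      (fun _ => 0) (fun q => tr q * om 2 q),
    row (fun q => -om 2 q) (fun q => ss q * om 2 q) (fun _ => 0)
      (fun q => -(tr q * om 0 q)) (fun q => -(tr q * om 1 q)),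
    row (fun _ => 0) (fun _ => 0) (fun _ => 1) (fun _ => 0) (fun _ => 0),
    row (fun _ => 0) (fun _ => 0) (fun _ => 0) (fun _ => 1) (fun _ => 0),
    row (fun _ => 0) (fun _ => 0) (fun _ => 0) (fun _ => 0) (fun _ => 1)]

lemma cZE_coef (i j) : Coef 0 (cZE i j) := by
  revert j
  fin_cases i <;> refine row_coef ?_ ?_ ?_ ?_ ?_ <;>
  first
  | exact Coef.g_const _
  | exact Coef.ri0
  | exact Coef.g_om _
  | exact Coef.g_ss
  | exact tr_coef
  | exact (Coef.g_om _).neg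
  | exact (Coef.ri0.mul0 (Coef.g_om _))
  | exact (Coef.ri0.mul0 (Coef.g_om _)).neg
  | exact (Coef.g_ss.mul0 (Coef.g_om _))
  | exact (tr_coef.mul0 (Coef.g_om _))
  | exact (tr_coef.mul0 (Coef.g_om _)).neg

lemma fZ_eq (i : Fin 11) (p : Pt) (hp : p ∈ U0) : fZ i p = ∑ j, cZE i j p • fE j p := by
  have h1 := rr_ri hp
  have h2 := om_sq hp
  have hx0 := x_eq hp 0
  have hx1 := x_eq hp 1
  have hx2 := x_eq hp 2
  have ht : p.1 = rr p - ss p := by simp [ss]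
  rw [Fintype.sum_option, Fin.sum_univ_four]
  refine Prod.ext ?_ (funext fun k => ?_)
  · fin_cases i <;> simp [fZ, cZE, row, fE, fY, VX, Vr, Rt, Bt, tr] <;> grind
  · fin_cases i <;> fin_cases k <;>
      simp [fZ, cZE, row, fE, fY, VX, Vr, Rt, Bt, tr, ev] <;> grind

lemma Coef.dZ {k : ℤ} {c : Pt → ℝ} (h : Coef k c) (i : Fin 11) : Coef k (dd (fZ i) c) := by
  have : Coef k (fun q => ∑ j, cZE i j q * dd (fE j) c q) := by
    simp only [Fintype.sum_option, Fin.sum_univ_four]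
    have e := fun j => (cZE_coef i j).mul0 (h.dE j)
    exact (e _).add ((((e _).add (e _)).add (e _)).add (e _))
  refine this.congr fun q hq => ?_
  simp only [dd]
  rw [fZ_eq i q hq, map_sum]
  simp

/-- The frame in terms of the Minkowski fields. -/
def cEZ : Option (Fin 4) → Fin 11 → Pt → ℝ
  | none => ![ss, fun _ => 0, fun _ => 0, fun _ => 0, fun _ => 1, fun _ => 0, fun _ => 0,
      fun _ => 0, fun _ => 0, fun _ => 0, fun _ => 0]
  | some i => (![![fun _ => 0, om 0, om 1, om 2, fun _ => 0, fun _ => 0, fun _ => 0,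
      fun _ => 0, fun _ => 0, fun _ => 0, fun _ => 0],
      ![fun _ => 0, fun _ => 0, fun _ => 0, fun _ => 0, fun _ => 0, fun _ => 0, fun _ => 0, fun _ => 0, fun _ => 1, fun _ => 0, fun _ => 0],
      ![fun _ => 0, fun _ => 0, fun _ => 0, fun _ => 0, fun _ => 0, fun _ => 0, fun _ => 0, fun _ => 0, fun _ => 0, fun _ => 1, fun _ => 0],
      ![fun _ => 0, fun _ => 0, fun _ => 0, fun _ => 0, fun _ => 0, fun _ => 0, fun _ => 0, fun _ => 0, fun _ => 0, fun _ => 0, fun _ => 1]] : Fin 4 → Fin 11 → Pt → ℝ) i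

lemma cEZ_coef (i j) : Coef 0 (cEZ i j) := by
  cases i with
  | none =>
    fin_cases j <;>
    first
    | exact Coef.g_const _
    | exact Coef.g_ss
  | some i =>
    fin_cases i
    · fin_cases j <;>
      first
      | exact Coef.g_const _
      | exact Coef.g_om _
    all_goals fin_cases j <;> exact Coef.g_const _

lemma fE_eq (i) (p : Pt) (hp : p ∈ U0) : fE i p = ∑ j, cEZ i j p • fZ j p := by
  have h1 := rr_ri hp
  have h2 := om_sq hp
  simp only [Fin.sum_univ_succ, Fin.sum_univ_zero]
  refine Prod.ext ?_ (funext fun k => ?_)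
  · rcases i with _ | i
    · simp [fZ, cEZ, fE, VX, ss, Fin.succ]
    · fin_cases i <;> simp [fZ, cEZ, fE, fY, Vr, Rt, Bt, Fin.succ]
  · rcases i with _ | i
    · fin_cases k <;> simp [fZ, cEZ, fE, VX, ss, Fin.succ, ev]
    · fin_cases i <;> fin_cases k <;>
        simp [fZ, cEZ, fE, fY, Vr, Rt, Bt, Fin.succ, ev]

/-- Tangential fields in terms of the coordinate fields. -/
def cYP : Fin 4 → Fin 3 → Pt → ℝ :=
  ![![om 0, om 1, om 2],
    ![fun q => -(om 1 q * rr q), fun q => om 0 q * rr q, fun q => 0 * rr q],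
    ![fun q => -(om 2 q * rr q), fun q => 0 * rr q, fun q => om 0 q * rr q],
    ![fun q => 0 * rr q, fun q => -(om 2 q * rr q), fun q => om 1 q * rr q]]

lemma cYP_coef (i j) : Coef 1 (cYP i j) := by
  fin_cases i <;> fin_cases j <;>
  first
  | exact (Coef.g_om _).weaken
  | exact (Coef.g_const _).mul0 Coef.g_rr
  | exact (Coef.g_om _).mul0 Coef.g_rr
  | exact ((Coef.g_om _).mul0 Coef.g_rr).neg

lemma fY_eq (i) (p : Pt) (hp : p ∈ U0) : fY i p = ∑ j, cYP i j p • fP j p := by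
  have hx0 := x_eq hp 0
  have hx1 := x_eq hp 1
  have hx2 := x_eq hp 2
  rw [Fin.sum_univ_three]
  refine Prod.ext ?_ (funext fun k => ?_)
  · fin_cases i <;> simp [fY, fP, cYP, Vr, Rt]
  · fin_cases i <;> fin_cases k <;> simp [fY, fP, cYP, Vr, Rt, ev] <;> grind

lemma Coef.dP {k : ℤ} {c : Pt → ℝ} (h : Coef k c) (i : Fin 3) : Coef k (dd (fP i) c) := by
  fin_cases i
  exacts [h.dZ 1, h.dZ 2, h.dZ 3]

lemma Coef.wE {k : ℤ} (w : List (Option (Fin 4))) : ∀ {c : Pt → ℝ}, Coef k c → Coef k (dw fE w c) := by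
  induction w with
  | nil => exact fun h => h
  | cons i w ih => exact fun h => ih (h.dE i)

lemma Coef.wZ {k : ℤ} (w : List (Fin 11)) : ∀ {c : Pt → ℝ}, Coef k c → Coef k (dw fZ w c) := by
  induction w with
  | nil => exact fun h => h
  | cons i w ih => exact fun h => ih (h.dZ i)

lemma Coef.wP {k : ℤ} (w : List (Fin 3)) : ∀ {c : Pt → ℝ}, Coef k c → Coef k (dw fP w c) := by
  induction w with
  | nil => exact fun h => h
  | cons i w ih => exact fun h => ih (h.dP i)

/-- The region where the solution lives. -/
def PR (R : ℝ) : Set Pt := {p | 0 ≤ p.1 ∧ p ∈ regA R}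

lemma PR_rr {R : ℝ} {p : Pt} (hp : p ∈ PR R) : 1 / R ≤ rr p := by
  obtain ⟨h0, h1, h2⟩ := hp
  unfold rr; linarith

lemma PR_sub {R : ℝ} (hR : 0 < R) : PR R ⊆ U0 := by
  intro p hp h0
  have h := PR_rr hp
  have : 0 < 1 / R := by positivity
  have h3 : rr p = 0 := by unfold rr; rw [h0]; exact rad_zero
  linarith

lemma om_le {p : Pt} (hp : p ∈ U0) (i : Fin 3) : |om i p| ≤ 1 := by
  have := om_sq hp
  rw [abs_le_one_iff_mul_self_le_one]
  have h0 := mul_self_nonneg (om 0 p)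
  have h1 := mul_self_nonneg (om 1 p)
  have h2 := mul_self_nonneg (om 2 p)
  fin_cases i
  · change om 0 p * om 0 p ≤ 1; linarith
  · change om 1 p * om 1 p ≤ 1; linarith
  · change om 2 p * om 2 p ≤ 1; linarith

lemma Coef.bound {R : ℝ} (hR : 0 < R) {k : ℤ} {c : Pt → ℝ} (h : Coef k c) :
    ∃ K, 0 < K ∧ ∀ p ∈ PR R, |c p| ≤ K * rr p ^ k := by
  induction h with
  | g_const a => exact ⟨|a| + 1, by positivity, fun p _ => by simp⟩
  | g_om i => exact ⟨1, one_pos, fun p hp => by simpa using om_le (PR_sub hR hp) i⟩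
  | g_ss =>
    refine ⟨R, hR, fun p hp => ?_⟩
    obtain ⟨h0, h1, h2⟩ := hp
    have : 0 < 1 / R := by positivity
    simp only [zpow_zero, mul_one, abs_le, ss, rr]
    constructor <;> linarith
  | g_rr => exact ⟨1, one_pos, fun p hp => by
      rw [abs_of_pos (rr_pos (PR_sub hR hp))]; simp⟩
  | g_ri => exact ⟨1, one_pos, fun p hp => by
      have := rr_pos (PR_sub hR hp)
      rw [ri, abs_of_pos (by positivity)]; simp⟩
  | mul _ _ h1 h2 =>
    obtain ⟨K, hK, h1⟩ := h1
    obtain ⟨L, hL, h2⟩ := h2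
    refine ⟨K * L, by positivity, fun p hp => ?_⟩
    have hr := rr_pos (PR_sub hR hp)
    rw [abs_mul, zpow_add₀ hr.ne']
    calc _ ≤ _ := mul_le_mul (h1 p hp) (h2 p hp) (abs_nonneg _) (by positivity)
      _ = _ := by ring
  | add _ _ h1 h2 =>
    obtain ⟨K, hK, h1⟩ := h1
    obtain ⟨L, hL, h2⟩ := h2
    refine ⟨K + L, by positivity, fun p hp => ?_⟩
    calc _ ≤ _ := abs_add_le _ _
      _ ≤ _ := add_le_add (h1 p hp) (h2 p hp)
      _ = _ := by ring
  | @weaken k a _ h =>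
    obtain ⟨K, hK, h⟩ := h
    refine ⟨K * R, by positivity, fun p hp => ?_⟩
    have hr := rr_pos (PR_sub hR hp)
    have h1 := PR_rr hp
    have h2 : 1 ≤ R * rr p := by rw [div_le_iff₀ hR] at h1; linarith
    refine (h p hp).trans ?_
    rw [zpow_add₀ hr.ne', zpow_one]
    have : 0 < K * rr p ^ k := by positivity
    calc _ ≤ _ := le_mul_of_one_le_right this.le h2
      _ = _ := by ring
  | congr _ h1 h =>
    obtain ⟨K, hK, h⟩ := h
    exact ⟨K, hK, fun p hp => by rw [h1 (PR_sub hR hp)]; exact h p hp⟩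

lemma fin_bound {ι : Type} [Finite ι] (n : ℕ) {Q : List ι → ℝ → Prop}
    (hmono : ∀ w K L, K ≤ L → Q w K → Q w L) (h : ∀ w, ∃ K, Q w K) :
    ∃ K, 0 < K ∧ ∀ w, w.length ≤ n → Q w K := by
  choose k hk using h
  obtain ⟨K, hK⟩ := ((words_finite ι n).image k).bddAbove
  refine ⟨max K 1, by positivity, fun w hw => hmono w (k w) _ ?_ (hk w)⟩
  exact le_trans (hK ⟨w, hw, rfl⟩) (le_max_left _ _)

/-- Words of bounded length on a symbol. -/
lemma Coef.wE_bound {R : ℝ} (hR : 0 < R) {k : ℤ} {c : Pt → ℝ} (h : Coef k c) (n : ℕ) :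
    ∃ K, 0 < K ∧ ∀ w : List (Option (Fin 4)), w.length ≤ n → ∀ p ∈ PR R,
      |dw fE w c p| ≤ K * rr p ^ k := by
  refine fin_bound n (Q := fun w K => ∀ p ∈ PR R, |dw fE w c p| ≤ K * rr p ^ k) ?_ ?_
  · intro w K L hKL hQ p hp
    have hr := rr_pos (PR_sub hR hp)
    refine (hQ p hp).trans (mul_le_mul_of_nonneg_right hKL (by positivity))
  · intro w
    obtain ⟨K, _, hK⟩ := (Coef.wE w h).bound hR
    exact ⟨K, hK⟩

lemma conv_ZE {R : ℝ} (hR : 0 < R) (n : ℕ) :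
    ∃ K, 0 < K ∧ ∀ u : Pt → ℝ, ContDiffOn ℝ n u U0 → ∀ p ∈ PR R, ∀ Bd : ℝ,
      (∀ v, v.length ≤ n → |dw fE v u p| ≤ Bd) →
      ∀ w, w.length ≤ n → |dw fZ w u p| ≤ K * Bd :=
  conv U0_open (PR_sub hR) (fZ_sm U0) fE_sm (fun i j => (cZE_coef i j).sm) fZ_eq
    (fun i j w => by
      obtain ⟨K, _, h⟩ := (Coef.wE w (cZE_coef i j)).bound hR
      exact ⟨K, by simpa using h⟩) n

lemma conv_EZ {R : ℝ} (hR : 0 < R) (n : ℕ) :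
    ∃ K, 0 < K ∧ ∀ u : Pt → ℝ, ContDiffOn ℝ n u U0 → ∀ p ∈ PR R, ∀ Bd : ℝ,
      (∀ v, v.length ≤ n → |dw fZ v u p| ≤ Bd) →
      ∀ w, w.length ≤ n → |dw fE w u p| ≤ K * Bd :=
  conv U0_open (PR_sub hR) fE_sm (fZ_sm U0) (fun i j => (cEZ_coef i j).sm) fE_eq
    (fun i j w => by
      obtain ⟨K, _, h⟩ := (Coef.wZ w (cEZ_coef i j)).bound hR
      exact ⟨K, by simpa using h⟩) n

/-- On the initial slice symbols of any order are bounded. -/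
lemma Coef.bound0 {R : ℝ} (hR : 0 < R) {c : Pt → ℝ} (h : Coef 1 c) :
    ∃ K, ∀ p ∈ PR R ∩ {p | p.1 = 0}, |c p| ≤ K := by
  obtain ⟨K, hK, h⟩ := h.bound hR
  refine ⟨K * R, fun p hp => (h p hp.1).trans ?_⟩
  have h1 := hp.1.2.2
  have h2 : p.1 = 0 := hp.2
  rw [h2, sub_zero] at h1
  rw [zpow_one]
  exact mul_le_mul_of_nonneg_left h1 hK.le

lemma conv_YP {R : ℝ} (hR : 0 < R) (n : ℕ) :
    ∃ K, 0 < K ∧ ∀ u : Pt → ℝ, ContDiffOn ℝ n u U0 → ∀ p ∈ PR R ∩ {p | p.1 = 0}, ∀ Bd : ℝ,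
      (∀ v, v.length ≤ n → |dw fP v u p| ≤ Bd) →
      ∀ w, w.length ≤ n → |dw fY w u p| ≤ K * Bd :=
  conv U0_open (Set.inter_subset_left.trans (PR_sub hR)) fY_sm (fP_sm U0)
    (fun i j => (cYP_coef i j).sm) fY_eq (fun i j w => (Coef.wP w (cYP_coef i j)).bound0 hR) n

/-! ### Part 3: translation and commutation -/

lemma hasDeriv_slice {u : Pt → ℝ} {p : Pt} (hu : DifferentiableAt ℝ u p) (i : Fin 3) :
    pxd i u p = fderiv ℝ u p (0, ev i) := by
  have h1 : HasDerivAt (fun s : ℝ => ((p.1, Function.update p.2 i s) : Pt)) (0, ev i) (p.2 i) := by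
    refine (hasDerivAt_const _ _).prodMk ?_
    have h0 : ev i = Pi.single i 1 := by
      funext k
      by_cases hk : k = i
      · subst hk; simp [ev]
      · simp [ev, hk]
    rw [h0]
    exact hasDerivAt_update p.2 i (p.2 i)
  have h2 : HasFDerivAt u (fderiv ℝ u p) (p.1, Function.update p.2 i (p.2 i)) := by
    simpa using hu.hasFDerivAt
  exact (h2.comp_hasDerivAt _ h1).deriv

lemma ptd_eq {u : Pt → ℝ} {p : Pt} (hu : DifferentiableAt ℝ u p) :
    ptd u p = fderiv ℝ u p (1, 0) := by
  have h1 : HasDerivAt (fun s : ℝ => ((s, p.2) : Pt)) (1, 0) p.1 :=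
    (hasDerivAt_id _).prodMk (hasDerivAt_const _ _)
  have h2 : HasFDerivAt u (fderiv ℝ u p) ((fun s : ℝ => ((s, p.2) : Pt)) p.1) := hu.hasFDerivAt
  exact (h2.comp_hasDerivAt _ h1).deriv

lemma fd_expand {u : Pt → ℝ} {p : Pt} (hu : DifferentiableAt ℝ u p) (v : Pt) :
    fderiv ℝ u p v = v.1 * ptd u p + ∑ i, v.2 i * pxd i u p := by
  have hv : v = v.1 • ((1, 0) : Pt) + ∑ i, v.2 i • ((0, ev i) : Pt) := by
    refine Prod.ext ?_ (funext fun k => ?_)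
    · simp [Prod.fst_sum]
    · fin_cases k <;> simp [Fin.sum_univ_three, ev]
  conv_lhs => rw [hv]
  rw [map_add, map_sum, map_smul, ptd_eq hu]
  simp only [map_smul, hasDeriv_slice hu, smul_eq_mul]

lemma mink_eq {u : Pt → ℝ} (hu : Differentiable ℝ u) (n : Fin 11) : mink n u = dd (fZ n) u := by
  funext p
  have h := fd_expand (hu p) (fZ n p)
  simp only [dd]
  rw [h]
  fin_cases n <;>
    simp [mink, fZ, Bt, Rt, vfS, vfBoost, vfRot, Fin.sum_univ_three, ev] <;> ring

lemma applyOps_append (L L' : List Op) (u : Pt → ℝ) :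
    applyOps (L ++ L') u = applyOps L (applyOps L' u) := by
  simp [applyOps, List.foldr_append]

lemma applyOps_eq (w : List (Fin 11)) : ∀ {u : Pt → ℝ}, ContDiff ℝ (w.length : ℕ) u →
    applyOps (w.map mink).reverse u = dw fZ w u := by
  induction w with
  | nil => intro u _; rfl
  | cons i w ih =>
    intro u hu
    have hd : Differentiable ℝ u := hu.differentiable (by simp)
    have h2 : ContDiff ℝ (w.length : ℕ) (dd (fZ i) u) := by
      rw [← contDiffOn_univ] at hu ⊢
      exact dd_cd isOpen_univ hu (fZ_sm _ i)
    simp only [List.map_cons, List.reverse_cons, applyOps_append, dw]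
    rw [← ih h2]
    congr 1
    simp [applyOps, mink_eq hd]

lemma isMulti_words (w : List (Fin 11)) : IsMulti (w.map mink).reverse := by
  intro Z hZ
  simp only [List.mem_reverse, List.mem_map] at hZ
  obtain ⟨n, _, rfl⟩ := hZ
  exact ⟨n, rfl⟩

lemma exists_word (L : List Op) (hL : IsMulti L) :
    ∃ w : List (Fin 11), w.length = L.length ∧ L = (w.map mink).reverse := by
  induction L with
  | nil => exact ⟨[], rfl, rfl⟩
  | cons Z L ih =>
    obtain ⟨w, h1, h2⟩ := ih fun Z hZ => hL Z (List.mem_cons_of_mem _ hZ)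
    obtain ⟨n, hn⟩ := hL Z List.mem_cons_self
    exact ⟨w ++ [n], by simp [h1], by simp [hn, ← h2]⟩

lemma rot_isMulti {L : List Op} (h : IsRotMulti L) : IsMulti L := by
  intro Z hZ
  rcases h Z hZ with h | h | h
  exacts [⟨8, h⟩, ⟨9, h⟩, ⟨10, h⟩]

lemma dd_dd {U : Set Pt} (hU : IsOpen U) {V W : Pt → Pt} (hW : SmOn W U) {u : Pt → ℝ}
    (hu : SmOn u U) {p : Pt} (hp : p ∈ U) :
    dd V (dd W u) p = fderiv ℝ (fderiv ℝ u) p (V p) (W p) + fderiv ℝ u p (fderiv ℝ W p (V p)) := by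
  have h1 : DifferentiableAt ℝ (fderiv ℝ u) p :=
    (((hu 2).fderiv_of_isOpen (m := 1) hU (by norm_num)).contDiffAt
      (hU.mem_nhds hp)).differentiableAt (by norm_num)
  have h2 : DifferentiableAt ℝ W p :=
    ((hW 1).contDiffAt (hU.mem_nhds hp)).differentiableAt (by norm_num)
  have := (h1.hasFDerivAt.clm_apply h2.hasFDerivAt).fderiv
  unfold dd
  rw [this]
  simp [add_comm]

lemma dd_comm {U : Set Pt} (hU : IsOpen U) {V W : Pt → Pt} (hV : SmOn V U) (hW : SmOn W U)
    {u : Pt → ℝ} (hu : SmOn u U) {p : Pt} (hp : p ∈ U)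
    (h : fderiv ℝ W p (V p) = fderiv ℝ V p (W p)) : dd V (dd W u) p = dd W (dd V u) p := by
  rw [dd_dd hU hW hu hp, dd_dd hU hV hu hp, h]
  have hs : IsSymmSndFDerivAt ℝ u p :=
    ((hu 2).contDiffAt (hU.mem_nhds hp)).isSymmSndFDerivAt (by simp)
  rw [hs.eq]

lemma fd_comp {V W : Pt → Pt} (hV : SmOn V U0) {p : Pt} (hp : p ∈ U0) :
    fderiv ℝ V p (W p) = (dd W (fun q => (V q).1) p, fun i => dd W (fun q => (V q).2 i) p) := by
  have h2 : DifferentiableAt ℝ V p :=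
    ((hV 1).contDiffAt (U0_open.mem_nhds hp)).differentiableAt (by norm_num)
  have h3 := h2.hasFDerivAt
  refine Prod.ext ?_ (funext fun i => ?_)
  · have := ((ContinuousLinearMap.fst ℝ ℝ Spc).hasFDerivAt.comp p h3).fderiv
    simp only [dd]
    change _ = fderiv ℝ ((ContinuousLinearMap.fst ℝ ℝ Spc) ∘ V) p (W p)
    rw [this]; rfl
  · have := (((ContinuousLinearMap.proj (R := ℝ) (φ := fun _ : Fin 3 => ℝ) i).comp
      (ContinuousLinearMap.snd ℝ ℝ Spc)).hasFDerivAt.comp p h3).fderiv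
    simp only [dd]
    change _ = fderiv ℝ (((ContinuousLinearMap.proj (R := ℝ) (φ := fun _ : Fin 3 => ℝ) i).comp
      (ContinuousLinearMap.snd ℝ ℝ Spc)) ∘ V) p (W p)
    rw [this]; rfl

lemma dd_Rtcomp (V : Pt → Pt) (a b k : Fin 3) (p : Pt) :
    dd V (fun q => (Rt a b q).2 k) p = (V p).2 a * ev b k - (V p).2 b * ev a k := by
  have : (fun q => (Rt a b q).2 k) = fun q : Pt => q.2 a * ev b k + q.2 b * (- ev a k) := by
    funext q; simp [Rt]; ring
  rw [this, dd_add (by fun_prop) (by fun_prop), dd_mul (by fun_prop) (by fun_prop),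
    dd_mul (by fun_prop) (by fun_prop), dd_coord, dd_coord, dd_const, dd_const]
  ring

lemma VD_comm (i : Fin 4) {u : Pt → ℝ} (hu : SmOn u U0) :
    Set.EqOn (dd VD (dd (fY i) u)) (dd (fY i) (dd VD u)) U0 := by
  intro p hp
  refine dd_comm U0_open VD_sm (fY_sm i) hu hp ?_
  rw [fd_comp (fY_sm i) hp, fd_comp VD_sm hp]
  rcases fY_rot (i := i) with h | ⟨a, b, h⟩ <;> rw [h]
  · refine Prod.ext ?_ (funext fun k => ?_)
    · simp [Vr, VD, dd_const]
    · have e1 := dd_om VD k hp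
      have e2 := dd_om Vr k hp
      rw [rr_VD hp] at e1
      rw [rr_Vr hp] at e2
      exact (e1.trans (by simp [VD, Vr])).trans e2.symm
  · refine Prod.ext ?_ (funext fun k => ?_)
    · simp [Rt, VD, dd_const]
    · have e2 := dd_om (Rt a b) k hp
      rw [rr_Rt _ _ hp, mul_zero, sub_zero, Rt_coord _ _ hp] at e2
      exact (dd_Rtcomp VD a b k p).trans e2.symm

lemma VD_comm_words (w : List (Fin 4)) : ∀ {u : Pt → ℝ}, SmOn u U0 →
    Set.EqOn (dd VD (dw fY w u)) (dw fY w (dd VD u)) U0 := by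
  induction w with
  | nil => intro u _ p _; rfl
  | cons i w ih =>
    intro u hu p hp
    have h1 := ih (dd_sm U0_open (fY_sm i) hu) hp
    have h2 := dw_congr U0_open (V := fY) w (VD_comm i hu) hp
    exact h1.trans h2

lemma dw_some (w : List (Fin 4)) : ∀ u, dw fE (w.map some) u = dw fY w u := by
  induction w with
  | nil => intro u; rfl
  | cons i w ih => intro u; exact ih _

lemma split_word {ι : Type} (w : List (Option ι)) :
    (∃ v : List ι, w = v.map some) ∨ ∃ (v : List ι) (w' : List (Option ι)),
      w = v.map some ++ none :: w' := by
  induction w with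
  | nil => exact Or.inl ⟨[], rfl⟩
  | cons a w ih =>
    cases a with
    | none => exact Or.inr ⟨[], w, rfl⟩
    | some a =>
      rcases ih with ⟨v, hv⟩ | ⟨v, w', hv⟩
      · exact Or.inl ⟨a :: v, by simp [hv]⟩
      · exact Or.inr ⟨a :: v, w', by simp [hv]⟩

lemma dd_VX {u : Pt → ℝ} {p : Pt} (hp : p ∈ U0) : dd VX u p = rr p * dd VD u p := by
  have : VX p = rr p • VD p := by
    refine Prod.ext ?_ (funext fun k => ?_)
    · simp [VX, VD]
    · simp [VX, VD, x_eq hp]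
  simp only [dd, this, map_smul, smul_eq_mul]

lemma slice_bound (w : List (Fin 3)) : ∀ {n : ℕ} {ε : ℝ} {u : Pt → ℝ},
    ContDiff ℝ (⊤ : ℕ∞) u →
    (∀ k ≤ n, ∀ x, ‖iteratedFDeriv ℝ k (fun x : Spc => u (0, x)) x‖ ≤ ε) → w.length ≤ n →
    ∀ x, |dw fP w u (0, x)| ≤ ε := by
  induction w with
  | nil =>
    intro n ε u _ h _ x
    have := h 0 (Nat.zero_le _) x
    simpa [dw] using this
  | cons i w ih =>
    intro n ε u hu h hw x
    obtain ⟨n, rfl⟩ : ∃ m, n = m + 1 := ⟨n - 1, by simp at hw; omega⟩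
    have hu' : ContDiff ℝ (⊤ : ℕ∞) (dd (fP i) u) := by
      have : ContDiff ℝ (⊤ : ℕ∞) (fderiv ℝ u) := hu.fderiv_right (by simp)
      exact this.clm_apply contDiff_const
    refine ih (n := n) hu' ?_ (by simpa using hw) x
    intro k hk y
    have hs : (fun x : Spc => dd (fP i) u (0, x))
        = fun x => fderiv ℝ (fun x : Spc => u (0, x)) x (ev i) := by
      funext x
      have h1 : HasFDerivAt (fun x : Spc => ((0, x) : Pt)) (ContinuousLinearMap.inr ℝ ℝ Spc) x :=
        (ContinuousLinearMap.inr ℝ ℝ Spc).hasFDerivAt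
      have h2 := HasFDerivAt.comp (f := fun x : Spc => ((0, x) : Pt)) x
        ((hu.differentiable (by simp)) (0, x)).hasFDerivAt h1
      have h3 := h2.fderiv
      change _ = fderiv ℝ (u ∘ fun x : Spc => ((0, x) : Pt)) x (ev i)
      rw [h3]; simp [dd, fP]
    rw [hs]
    have hsm : ContDiff ℝ (⊤ : ℕ∞) (fun x : Spc => u (0, x)) :=
      hu.comp (contDiff_const.prodMk contDiff_id)
    have hsm' : ContDiff ℝ (⊤ : ℕ∞) (fderiv ℝ (fun x : Spc => u (0, x))) :=
      hsm.fderiv_right (by simp)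
    refine (norm_iteratedFDeriv_clm_apply_const (N := (⊤ : ℕ∞)) (n := k) (c := ev i)
      hsm'.contDiffAt (by exact_mod_cast le_top)).trans ?_
    rw [norm_iteratedFDeriv_fderiv]
    have he : ‖ev i‖ ≤ 1 := by
      refine (pi_norm_le_iff_of_nonneg zero_le_one).mpr fun k => ?_
      simp only [ev]; split_ifs <;> simp
    calc _ ≤ 1 * ‖iteratedFDeriv ℝ (k + 1) (fun x : Spc => u (0, x)) y‖ :=
          mul_le_mul_of_nonneg_right he (norm_nonneg _)
      _ ≤ ε := by rw [one_mul]; exact h _ (by omega) _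

/-- Outgoing characteristics. -/
def ch (q : ℝ) (o : Spc) (τ : ℝ) : Pt := (τ, fun i => (q + τ) * o i)

lemma ch_rr {q : ℝ} {o : Spc} (ho : o 0 * o 0 + o 1 * o 1 + o 2 * o 2 = 1) {τ : ℝ}
    (h : 0 ≤ q + τ) : rr (ch q o τ) = q + τ := by
  simp only [rr, rad, ch, Fin.sum_univ_three]
  rw [show ((q + τ) * o 0) ^ 2 + ((q + τ) * o 1) ^ 2 + ((q + τ) * o 2) ^ 2 = (q + τ) ^ 2 by
    linear_combination (q + τ) ^ 2 * ho]
  exact Real.sqrt_sq h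

lemma ch_U0 {q : ℝ} {o : Spc} (ho : o 0 * o 0 + o 1 * o 1 + o 2 * o 2 = 1) {τ : ℝ}
    (h : 0 < q + τ) : ch q o τ ∈ U0 := by
  intro h0
  have h1 := ch_rr ho h.le
  have h2 : rr (ch q o τ) = 0 := by unfold rr; rw [h0]; exact rad_zero
  linarith

lemma ch_VD {q : ℝ} {o : Spc} (ho : o 0 * o 0 + o 1 * o 1 + o 2 * o 2 = 1) {τ : ℝ}
    (h : 0 < q + τ) : VD (ch q o τ) = (1, o) := by
  refine Prod.ext rfl (funext fun k => ?_)
  simp only [VD, om, ri, ch_rr ho h.le]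
  simp only [ch]
  field_simp

lemma ch_deriv (q : ℝ) (o : Spc) (τ : ℝ) : HasDerivAt (ch q o) (1, o) τ := by
  refine (hasDerivAt_id _).prodMk (hasDerivAt_pi.mpr fun i => ?_)
  have := ((hasDerivAt_id τ).const_add q).mul_const (o i)
  simpa using this

lemma ch_self {p : Pt} (hp : p ∈ U0) : ch (ss p) (fun i => om i p) p.1 = p := by
  refine Prod.ext rfl (funext fun k => ?_)
  simp [ch, ss, ← x_eq hp]

lemma ch_dd {q : ℝ} {o : Spc} (ho : o 0 * o 0 + o 1 * o 1 + o 2 * o 2 = 1) {τ : ℝ}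
    (h : 0 < q + τ) {u : Pt → ℝ} (hu : DifferentiableAt ℝ u (ch q o τ)) :
    HasDerivAt (fun τ => u (ch q o τ)) (dd VD u (ch q o τ)) τ := by
  have := hu.hasFDerivAt.comp_hasDerivAt τ (ch_deriv q o τ)
  rw [← ch_VD ho h] at this
  exact this

lemma grow {φ φ' : ℝ → ℝ} {T q C : ℝ} (hT : 0 ≤ T) (hq : 0 < q) (hC : 0 ≤ C)
    (hc : ContinuousOn φ (Set.Icc 0 T)) (hd : ∀ τ ∈ Set.Ioo 0 T, HasDerivAt φ (φ' τ) τ)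
    (hb : ∀ τ ∈ Set.Ioo 0 T, |φ' τ| ≤ C / (q + τ) ^ 2) : |φ T| ≤ |φ 0| + C / q := by
  have hψ : ∀ τ ∈ Set.Icc 0 T, HasDerivAt (fun τ => - (C / (q + τ))) (C / (q + τ) ^ 2) τ := by
    intro τ hτ
    have hpos : q + τ ≠ 0 := by have := hτ.1; positivity
    have h1 := (((hasDerivAt_id τ).const_add q).inv hpos).const_mul (-C)
    have e1 : (fun τ => - (C / (q + τ))) = fun τ => -C * (q + τ)⁻¹ := by
      funext t; rw [div_eq_mul_inv]; ring
    have e2 : C / (q + τ) ^ 2 = -C * (-1 / (q + τ) ^ 2) := by ring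
    rw [e1, e2]
    exact h1
  have key : ∀ s : ℝ, |s| = 1 → s * φ T ≤ s * φ 0 + C / q := by
    intro s hs
    have hanti : AntitoneOn (fun τ => s * φ τ - (-(C / (q + τ)))) (Set.Icc 0 T) := by
      refine antitoneOn_of_hasDerivWithinAt_nonpos (f' := fun τ => s * φ' τ - C / (q + τ) ^ 2)
        (convex_Icc 0 T) ?_ ?_ ?_
      · exact (continuousOn_const.mul hc).sub fun τ hτ => (hψ τ hτ).continuousAt.continuousWithinAt
      · intro τ hτ
        rw [interior_Icc] at hτ ⊢
        exact (((hd τ hτ).const_mul s).sub (hψ τ (Set.Ioo_subset_Icc_self hτ))).hasDerivWithinAt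
      · intro τ hτ
        rw [interior_Icc] at hτ
        have h1 := hb τ hτ
        have h2 : s * φ' τ ≤ |φ' τ| := by
          calc _ ≤ |s * φ' τ| := le_abs_self _
            _ = _ := by rw [abs_mul, hs, one_mul]
        linarith
    have := hanti (Set.left_mem_Icc.mpr hT) (Set.right_mem_Icc.mpr hT) hT
    have hp : 0 ≤ C / (q + T) := by positivity
    simp only [add_zero] at this
    linarith
  have h1 := key 1 (by simp)
  have h2 := key (-1) (by simp)
  have h3 := le_abs_self (φ 0)
  have h4 := neg_abs_le (φ 0)
  rw [abs_le]
  constructor <;> linarith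

/-! ### Part 4: the estimates -/

/-- The hypotheses of the theorem, in terms of words. -/
structure Hyp (M : ℕ) (R ε : ℝ) (f μ g : Pt → ℝ) : Prop where
  hf : ContDiff ℝ (⊤ : ℕ∞) f
  hμ : ContDiff ℝ (M : ℕ) μ
  hg : ContDiff ℝ (M : ℕ) g
  eqn : ∀ p : Pt, 0 ≤ p.1 → p ∈ U0 → dd VD f p + f p * ri p = f p * μ p + g p
  init : ∀ x, x ∉ regA0 R → f (0, x) = 0
  cm : CMBound M (fun x => f (0, x)) ε
  supp : ∀ p : Pt, 0 ≤ p.1 → p ∉ regA R → g p = 0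
  bd : ∀ w : List (Fin 11), w.length ≤ M → ∀ p : Pt, 0 ≤ p.1 →
    (1 + rr p) ^ 2 * |dw fZ w μ p| + (1 + rr p) ^ 3 * |dw fZ w g p| ≤ ε

/-- `r f`. -/
def Ff (f : Pt → ℝ) (q : Pt) : ℝ := rr q * f q

/-- `r g`. -/
def src (μ g f : Pt → ℝ) (q : Pt) : ℝ := μ q * Ff f q + rr q * g q

/-- The open set `t > 0, x ≠ 0`. -/
def Up : Set Pt := {p | 0 < p.1} ∩ U0

lemma Up_open : IsOpen Up := (isOpen_lt continuous_const continuous_fst).inter U0_open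

lemma Up_sub : Up ⊆ U0 := Set.inter_subset_right

lemma SmOn.mono {X : Type*} [NormedAddCommGroup X] [NormedSpace ℝ X] {u : Pt → X} {U V : Set Pt}
    (h : SmOn u U) (hVU : V ⊆ U) : SmOn u V := fun n => (h n).mono hVU

section
variable {M : ℕ} {R ε : ℝ} {f μ g : Pt → ℝ}

lemma Hyp.fsm (h : Hyp M R ε f μ g) (U : Set Pt) : SmOn f U := fun _ =>
  (h.hf.of_le (by exact_mod_cast le_top)).contDiffOn

lemma Hyp.Fsm (h : Hyp M R ε f μ g) : SmOn (Ff f) U0 := fun n => (rr_sm n).mul (h.fsm U0 n)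

lemma Hyp.srcM (h : Hyp M R ε f μ g) : ContDiffOn ℝ M (src μ g f) U0 :=
  (h.hμ.contDiffOn.mul (h.Fsm M)).add ((rr_sm M).mul h.hg.contDiffOn)

lemma Hyp.transport (h : Hyp M R ε f μ g) : Set.EqOn (dd VD (Ff f)) (src μ g f) Up := by
  intro p hp
  have h0 := Up_sub hp
  have h1 := dd_mul (V := VD) (sm_diff U0_open rr_sm h0) (sm_diff U0_open (h.fsm U0) h0)
  have h2 := h.eqn p (le_of_lt hp.1) h0
  have h3 := rr_ri h0
  refine h1.trans ?_
  rw [rr_VD h0]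
  simp only [src, Ff]
  linear_combination rr p * h2 - f p * h3

lemma Hyp.support (h : Hyp M R ε f μ g) {p : Pt} (hp0 : 0 ≤ p.1) (hp : p ∈ U0)
    (hpA : p ∉ regA R) : f p = 0 := by
  set q := ss p with hq
  set o : Spc := fun i => om i p with hodef
  have ho : o 0 * o 0 + o 1 * o 1 + o 2 * o 2 = 1 := om_sq hp
  have hnA : ¬ (1 / R ≤ q ∧ q ≤ R) := fun hh => hpA ⟨hh.1, hh.2⟩
  have hsm1 : ContDiff ℝ (⊤ : ℕ∞) (ch q o) := by unfold ch; fun_prop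
  have hfd : Differentiable ℝ f := h.hf.differentiable (by simp)
  have hfc : Continuous (fun τ => fderiv ℝ f (ch q o τ) (1, o)) :=
    (((h.hf.fderiv_right (m := (⊤ : ℕ∞)) (by simp)).continuous).comp hsm1.continuous).clm_apply
      continuous_const
  set φ : ℝ → ℝ := fun τ => (q + τ) * f (ch q o τ) with hφ
  set φ' : ℝ → ℝ := fun τ => f (ch q o τ) + (q + τ) * fderiv ℝ f (ch q o τ) (1, o) with hφ'
  have hfcc : Continuous (fun τ => f (ch q o τ)) := h.hf.continuous.comp hsm1.continuous
  have hder : ∀ τ, HasDerivAt φ (φ' τ) τ := by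
    intro τ
    have h1 := (hfd (ch q o τ)).hasFDerivAt.comp_hasDerivAt τ (ch_deriv q o τ)
    have h2 := ((hasDerivAt_id τ).const_add q).mul h1
    have e : φ' τ = 1 * f (ch q o τ) + (q + τ) * fderiv ℝ f (ch q o τ) (1, o) := by
      simp [hφ']
    rw [e]
    exact h2
  have hφc : Continuous φ := (continuous_const.add continuous_id).mul hfcc
  have hφc' : Continuous φ' := hfcc.add ((continuous_const.add continuous_id).mul hfc)
  set a : ℝ := max 0 (-q) with ha
  have hb1 : ∀ τ ∈ Set.Ioi a, |φ' τ| ≤ ε * |φ τ| := by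
    intro τ hτ
    have hτ0 : 0 < τ := lt_of_le_of_lt (le_max_left _ _) hτ
    have hτq : 0 < q + τ := by
      have : -q < τ := lt_of_le_of_lt (le_max_right _ _) hτ
      linarith
    have hU := ch_U0 ho hτq
    have hrr := ch_rr ho hτq.le
    have e := h.eqn (ch q o τ) hτ0.le hU
    have hg0 : g (ch q o τ) = 0 := by
      refine h.supp _ hτ0.le fun hA => hnA ?_
      have e1 : rad (ch q o τ).2 = q + τ := hrr
      have e2 : (ch q o τ).1 = τ := rfl
      obtain ⟨h1, h2⟩ := hA
      rw [e1, e2] at h1 h2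
      constructor <;> linarith
    have hdd : dd VD f (ch q o τ) = fderiv ℝ f (ch q o τ) (1, o) := by
      simp only [dd, ch_VD ho hτq]
    have hri := rr_ri hU
    rw [hrr] at hri
    rw [hg0, hdd] at e
    have hval : φ' τ = μ (ch q o τ) * φ τ := by
      simp only [hφ, hφ']
      linear_combination (q + τ) * e - f (ch q o τ) * hri
    rw [hval, abs_mul]
    refine mul_le_mul_of_nonneg_right ?_ (abs_nonneg _)
    have hm := h.bd [] (by simp) (ch q o τ) hτ0.le
    simp only [dw] at hm
    have hr0 := rr_pos hU
    have h1 : 0 ≤ (1 + rr (ch q o τ)) ^ 3 * |g (ch q o τ)| := by positivity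
    have h2 : 1 ≤ (1 + rr (ch q o τ)) ^ 2 := one_le_pow₀ (by linarith)
    have h3 := le_mul_of_one_le_left (abs_nonneg (μ (ch q o τ))) h2
    linarith
  have hb2 : ∀ τ ∈ Set.Ici a, |φ' τ| ≤ ε * |φ τ| := by
    have hcl : IsClosed {τ | |φ' τ| ≤ ε * |φ τ|} :=
      isClosed_le hφc'.abs (continuous_const.mul hφc.abs)
    have := hcl.closure_subset_iff.mpr (show Set.Ioi a ⊆ {τ | |φ' τ| ≤ ε * |φ τ|} from hb1)
    rwa [closure_Ioi] at this
  have hφa : φ a = 0 := by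
    rcases le_or_gt q 0 with hq0 | hq0
    · have : a = -q := max_eq_right (by linarith)
      simp [hφ, this]
    · have ha0 : a = 0 := max_eq_left (by linarith)
      have : f (ch q o 0) = 0 := by
        have e1 : rad (fun i => (q + 0) * o i) = q + 0 := ch_rr (q := q) (τ := 0) ho (by linarith)
        refine h.init _ fun hA => hnA ?_
        obtain ⟨h1, h2⟩ := hA
        rw [e1] at h1 h2
        constructor <;> linarith
      simp [hφ, ha0, this]
  have hat : a ≤ p.1 := max_le hp0 (by
    have := rr_pos hp
    simp only [hq, ss]; linarith)
  have hfin := norm_le_gronwallBound_of_norm_deriv_right_le (f := φ) (f' := φ') (δ := 0) (K := ε)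
    (ε := 0) (a := a) (b := p.1) hφc.continuousOn (fun x _ => (hder x).hasDerivWithinAt)
    (by simp [hφa]) (fun x hx => by simpa using hb2 x hx.1) p.1 (Set.right_mem_Icc.mpr hat)
  rw [gronwallBound_ε0_δ0] at hfin
  have hz : φ p.1 = 0 := by simpa using hfin
  have hcs : ch q o p.1 = p := ch_self hp
  simp only [hφ, hcs] at hz
  have : q + p.1 ≠ 0 := by
    have := rr_pos hp
    simp only [hq, ss]; linarith
  exact (mul_eq_zero.mp hz).resolve_left this

end

/-- Bounds on the initial slice. -/
lemma init_bound (M : ℕ) {R : ℝ} (hR : 0 < R) : ∃ K, 0 < K ∧ ∀ ε f μ g, Hyp M R ε f μ g →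
    ∀ p ∈ PR R, p.1 = 0 → ∀ w : List (Fin 4), w.length ≤ M → |dw fY w (Ff f) p| ≤ K * ε := by
  obtain ⟨K1, hK1, h1⟩ := conv_YP hR M
  obtain ⟨K2, hK2, h2⟩ := fin_bound M
    (Q := fun (w : List (Fin 3)) K => ∀ p ∈ PR R ∩ {p | p.1 = 0}, |dw fP w rr p| ≤ K)
    (fun w K L hKL hQ p hp => (hQ p hp).trans hKL)
    (fun w => (Coef.wP w Coef.g_rr).bound0 hR)
  refine ⟨K1 * (2 ^ M * K2), by positivity, ?_⟩
  intro ε f μ g h p hp hp0 w hw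
  have := h1 (Ff f) (h.Fsm M) p ⟨hp, hp0⟩ (2 ^ M * (K2 * ε)) ?_ w hw
  · refine this.trans (le_of_eq (by ring))
  · intro v hv
    refine dw_mul_bound U0_open (fP_sm U0) (PR_sub hR hp) M v hv (rr_sm M) (h.fsm U0 M) ?_ ?_
    · exact fun v hv => h2 v hv p ⟨hp, hp0⟩
    · intro v hv
      have hpe : p = (0, p.2) := Prod.ext hp0 rfl
      rw [hpe]
      exact slice_bound v h.hf h.cm hv p.2

/-- Bounds on the coefficients and the source. -/
lemma coef_bound (M : ℕ) {R : ℝ} (hR : 0 < R) : ∃ K, 0 < K ∧ ∀ ε f μ g, Hyp M R ε f μ g →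
    ∀ p ∈ PR R, ∀ w : List (Option (Fin 4)), w.length ≤ M →
      |dw fE w μ p| ≤ K * ε * (ri p) ^ 2 ∧ |dw fE w (fun q => rr q * g q) p| ≤ K * ε * (ri p) ^ 2 := by
  obtain ⟨K1, hK1, h1⟩ := conv_EZ hR M
  obtain ⟨K2, hK2, h2⟩ := Coef.g_rr.wE_bound hR M
  refine ⟨K1 + 2 ^ M * (K2 * K1), by positivity, ?_⟩
  intro ε f μ g h p hp w hw
  have hU := PR_sub hR hp
  have hr := rr_pos hU
  have hri : ri p = (rr p)⁻¹ := rfl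
  have hri0 : 0 < ri p := by rw [hri]; positivity
  have hrr := rr_ri hU
  have hε : 0 ≤ ε := by
    refine le_trans ?_ (h.bd [] (by simp) p hp.1)
    positivity
  have hZμ : ∀ v : List (Fin 11), v.length ≤ M → |dw fZ v μ p| ≤ ε * ri p ^ 2 := by
    intro v hv
    have hb := h.bd v hv p hp.1
    have e1 : rr p ^ 2 * |dw fZ v μ p| ≤ ε := by
      refine le_trans ?_ hb
      have : rr p ^ 2 * |dw fZ v μ p| ≤ (1 + rr p) ^ 2 * |dw fZ v μ p| := by gcongr; linarith
      have : 0 ≤ (1 + rr p) ^ 3 * |dw fZ v g p| := by positivity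
      linarith
    calc |dw fZ v μ p| = (rr p * ri p) ^ 2 * |dw fZ v μ p| := by rw [hrr]; ring
      _ = (rr p ^ 2 * |dw fZ v μ p|) * ri p ^ 2 := by ring
      _ ≤ _ := by gcongr
  have hZg : ∀ v : List (Fin 11), v.length ≤ M → |dw fZ v g p| ≤ ε * ri p ^ 3 := by
    intro v hv
    have hb := h.bd v hv p hp.1
    have e1 : rr p ^ 3 * |dw fZ v g p| ≤ ε := by
      refine le_trans ?_ hb
      have : rr p ^ 3 * |dw fZ v g p| ≤ (1 + rr p) ^ 3 * |dw fZ v g p| := by gcongr; linarith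
      have : 0 ≤ (1 + rr p) ^ 2 * |dw fZ v μ p| := by positivity
      linarith
    calc |dw fZ v g p| = (rr p * ri p) ^ 3 * |dw fZ v g p| := by rw [hrr]; ring
      _ = (rr p ^ 3 * |dw fZ v g p|) * ri p ^ 3 := by ring
      _ ≤ _ := by gcongr
  have hEμ := h1 μ h.hμ.contDiffOn p hp _ hZμ
  have hEg := h1 g h.hg.contDiffOn p hp _ hZg
  have hX : 0 ≤ ε * ri p ^ 2 := by positivity
  constructor
  · refine (hEμ w hw).trans ?_
    have : 0 ≤ (2 ^ M * (K2 * K1)) * (ε * ri p ^ 2) := by positivity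
    nlinarith
  · have := dw_mul_bound U0_open fE_sm hU M w hw (rr_sm M) h.hg.contDiffOn
      (fun v hv => h2 v hv p hp) hEg
    refine this.trans ?_
    rw [zpow_one]
    calc _ = 2 ^ M * (K2 * K1) * (ε * ri p ^ 2) * (rr p * ri p) := by ring
      _ = 2 ^ M * (K2 * K1) * (ε * ri p ^ 2) := by rw [hrr, mul_one]
      _ ≤ _ := by nlinarith

lemma ri_le {R : ℝ} (hR : 0 < R) {p : Pt} (hp : p ∈ PR R) : ri p ≤ R := by
  have h1 := PR_rr hp
  have hU := PR_sub hR hp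
  have hr := rr_pos hU
  rw [ri, inv_le_comm₀ hr hR]
  simpa using h1

/-- The energy-type estimate for the tangential fields. -/
lemma Y_bound (M : ℕ) {R : ℝ} (hR : 0 < R) : ∃ ε₀, 0 < ε₀ ∧ ∃ C, 0 < C ∧ ∀ ε f μ g, 0 < ε → ε ≤ ε₀ →
    Hyp M R ε f μ g → ∀ p ∈ PR R, ∀ w : List (Fin 4), w.length ≤ M →
      |dw fY w (Ff f) p| ≤ C * ε := by
  obtain ⟨K0, hK0, h0⟩ := init_bound M hR
  obtain ⟨K1, hK1, h1⟩ := coef_bound M hR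
  set S : Finset (List (Fin 4)) := (words_finite (Fin 4) M).toFinset with hS
  have hmem : ∀ w, w ∈ S ↔ w.length ≤ M := by intro w; simp [hS]
  set N : ℝ := (S.card : ℝ) with hN
  have hN0 : 0 ≤ N := by positivity
  refine ⟨1 / (2 * (N * (R * (2 ^ M * K1))) + 1), by positivity,
    2 * N * (K0 + R * K1) + 1, by positivity, ?_⟩
  intro ε f μ g hε hε0 h p hp w hw
  have hpU := PR_sub hR hp
  set q := ss p with hq
  set o : Spc := fun i => om i p with hodef
  have ho : o 0 * o 0 + o 1 * o 1 + o 2 * o 2 = 1 := om_sq hpU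
  have hq1 : 1 / R ≤ q := hp.2.1
  have hq2 : q ≤ R := hp.2.2
  have hq0 : 0 < q := lt_of_lt_of_le (by positivity) hq1
  have hqR : 1 / q ≤ R := by
    rw [div_le_iff₀ hq0]; rw [div_le_iff₀ hR] at hq1; linarith
  set T := p.1 with hT
  have hT0 : 0 ≤ T := hp.1
  have hPR : ∀ τ, 0 ≤ τ → ch q o τ ∈ PR R := by
    intro τ hτ
    have e := ch_rr (q := q) (τ := τ) ho (by linarith)
    refine ⟨hτ, ?_, ?_⟩
    · change 1 / R ≤ rr (ch q o τ) - τ; rw [e]; linarith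
    · change rr (ch q o τ) - τ ≤ R; rw [e]; linarith
  have hdiff : ∀ v : List (Fin 4), ∀ τ, 0 ≤ τ →
      HasDerivAt (fun τ => dw fY v (Ff f) (ch q o τ)) (dd VD (dw fY v (Ff f)) (ch q o τ)) τ := by
    intro v τ hτ
    have hp : 0 < q + τ := by linarith
    exact ch_dd ho hp (sm_diff U0_open (dw_sm U0_open fY_sm v h.Fsm) (ch_U0 ho hp))
  have hcont : ∀ v : List (Fin 4), ContinuousOn (fun τ => dw fY v (Ff f) (ch q o τ))
      (Set.Icc 0 T) := fun v τ hτ => (hdiff v τ hτ.1).continuousAt.continuousWithinAt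
  set Φ : ℝ → ℝ := fun τ => ∑ v ∈ S, |dw fY v (Ff f) (ch q o τ)| with hΦ
  have hΦc : ContinuousOn Φ (Set.Icc 0 T) := continuousOn_finset_sum _ fun v _ => (hcont v).abs
  obtain ⟨τ₀, hτ₀, hmax⟩ := isCompact_Icc.exists_isMaxOn (Set.nonempty_Icc.mpr hT0) hΦc
  set m := Φ τ₀ with hm
  have hm0 : 0 ≤ m := Finset.sum_nonneg fun v _ => abs_nonneg _
  have hle : ∀ τ ∈ Set.Icc 0 T, ∀ v : List (Fin 4), v.length ≤ M →
      |dw fY v (Ff f) (ch q o τ)| ≤ m := by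
    intro τ hτ v hv
    refine le_trans ?_ (hmax hτ)
    exact Finset.single_le_sum (f := fun v => |dw fY v (Ff f) (ch q o τ)|)
      (fun v _ => abs_nonneg _) ((hmem v).mpr hv)
  set D := 2 ^ M * K1 * ε * m + K1 * ε with hD
  have hD0 : 0 ≤ D := by positivity
  have hder : ∀ v : List (Fin 4), v.length ≤ M → ∀ τ ∈ Set.Ioo 0 T,
      |dd VD (dw fY v (Ff f)) (ch q o τ)| ≤ D / (q + τ) ^ 2 := by
    intro v hv τ hτ
    have hqτ : 0 < q + τ := by linarith [hτ.1]
    have hcU := ch_U0 ho hqτ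
    have hcP := hPR τ hτ.1.le
    have hcUp : ch q o τ ∈ Up := ⟨hτ.1, hcU⟩
    have hri : ri (ch q o τ) = (q + τ)⁻¹ := by rw [ri, ch_rr ho hqτ.le]
    have hμs := h.hμ.contDiffOn (s := U0)
    have hgs : ContDiffOn ℝ M (fun q => rr q * g q) U0 := (rr_sm M).mul h.hg.contDiffOn
    rw [VD_comm_words v h.Fsm hcU, dw_congr Up_open v h.transport hcUp]
    have e := dw_add U0_open fY_sm v (cd_le hv (hμs.mul (h.Fsm M))) (cd_le hv hgs) hcU
    have e1 := dw_mul_bound U0_open fY_sm hcU M v hv hμs (h.Fsm M)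
      (A := K1 * ε * ri (ch q o τ) ^ 2) (B := m)
      (fun v hv => by
        have := (h1 ε f μ g h _ hcP (v.map some) (by simpa using hv)).1
        rwa [dw_some] at this)
      (fun v hv => hle τ (Set.Ioo_subset_Icc_self hτ) v hv)
    have e2 := (h1 ε f μ g h _ hcP (v.map some) (by simpa using hv)).2
    rw [dw_some] at e2
    have e' : dw fY v (src μ g f) (ch q o τ) = _ := e
    rw [e']
    refine (abs_add_le _ _).trans ((add_le_add e1 e2).trans (le_of_eq ?_))
    rw [hri, hD]
    field_simp
  have hgrow : ∀ v : List (Fin 4), v.length ≤ M →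
      |dw fY v (Ff f) (ch q o τ₀)| ≤ K0 * ε + R * D := by
    intro v hv
    have hsub : Set.Icc 0 τ₀ ⊆ Set.Icc 0 T := Set.Icc_subset_Icc_right hτ₀.2
    have := grow (φ := fun τ => dw fY v (Ff f) (ch q o τ))
      (φ' := fun τ => dd VD (dw fY v (Ff f)) (ch q o τ)) hτ₀.1 hq0 hD0 ((hcont v).mono hsub)
      (fun τ hτ => hdiff v τ hτ.1.le)
      (fun τ hτ => hder v hv τ ⟨hτ.1, lt_of_lt_of_le hτ.2 hτ₀.2⟩)
    refine this.trans (add_le_add (h0 ε f μ g h _ (hPR 0 le_rfl) rfl v hv) ?_)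
    calc D / q = (1 / q) * D := by ring
      _ ≤ R * D := by gcongr
  have hmle : m ≤ N * (K0 * ε + R * D) := by
    have := Finset.sum_le_card_nsmul S (fun v => |dw fY v (Ff f) (ch q o τ₀)|) (K0 * ε + R * D)
      (fun v hv => hgrow v ((hmem v).mp hv))
    rwa [nsmul_eq_mul] at this
  have hsmall : ε * (2 * (N * (R * (2 ^ M * K1))) + 1) ≤ 1 := by
    rwa [le_div_iff₀ (by positivity)] at hε0
  have hfin : m ≤ 2 * N * (K0 + R * K1) * ε := by
    have e1 : N * (K0 * ε + R * D) = N * (K0 + R * K1) * ε + (ε * (N * (R * (2 ^ M * K1)))) * m := by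
      rw [hD]; ring
    have e2 : (ε * (N * (R * (2 ^ M * K1)))) * m ≤ (1 / 2) * m := by
      refine mul_le_mul_of_nonneg_right ?_ hm0
      nlinarith
    rw [e1] at hmle
    linarith
  have hcs : ch q o T = p := ch_self hpU
  have hT' := hle T (Set.right_mem_Icc.mpr hT0) w hw
  rw [hcs] at hT'
  nlinarith

/-- The estimate for the full frame. -/
lemma E_bound (M : ℕ) {R : ℝ} (hR : 0 < R) : ∃ ε₀, 0 < ε₀ ∧ ∀ n ≤ M, ∃ C, 0 < C ∧
    ∀ ε f μ g, 0 < ε → ε ≤ ε₀ →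
    Hyp M R ε f μ g → ∀ p ∈ PR R, 0 < p.1 → ∀ w : List (Option (Fin 4)), w.length ≤ n →
      |dw fE w (Ff f) p| ≤ C * ε := by
  obtain ⟨ε₁, hε₁, C0, hC0, hY⟩ := Y_bound M hR
  obtain ⟨K1, hK1, h1⟩ := coef_bound M hR
  obtain ⟨K2, hK2, h2⟩ := Coef.g_rr.wE_bound hR M
  refine ⟨min ε₁ 1, by positivity, ?_⟩
  intro n
  induction n with
  | zero =>
    intro _
    refine ⟨C0, hC0, ?_⟩
    intro ε f μ g hε hε0 h p hp _ w hw
    obtain rfl : w = [] := List.length_eq_zero_iff.mp (by omega)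
    exact hY ε f μ g hε (hε0.trans (min_le_left _ _)) h p hp [] (by simp)
  | succ n ih =>
    intro hn
    obtain ⟨Cn, hCn, ih⟩ := ih (by omega)
    set K' := 2 ^ n * (K1 * Cn) + K1 with hK'
    have hK'0 : 0 < K' := by positivity
    refine ⟨C0 + 2 ^ n * (K2 * K') * R, by positivity, ?_⟩
    intro ε f μ g hε hε0 h p hp hpt w hw
    have hε1 : ε ≤ 1 := hε0.trans (min_le_right _ _)
    have hU := PR_sub hR hp
    have hUp : p ∈ Up := ⟨hpt, hU⟩
    have hri0 : 0 < ri p := inv_pos.mpr (rr_pos hU)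
    rcases split_word w with ⟨v, rfl⟩ | ⟨v, w', rfl⟩
    · rw [dw_some]
      have := hY ε f μ g hε (hε0.trans (min_le_left _ _)) h p hp v (by simp at hw; omega)
      have e : 0 ≤ 2 ^ n * (K2 * K') * R * ε := by positivity
      nlinarith
    · have hlen : v.length + w'.length ≤ n := by simp at hw; omega
      have hH : ∀ u : List (Option (Fin 4)), u.length ≤ n →
          |dw fE u (src μ g f) p| ≤ K' * ε * ri p ^ 2 := by
        intro u hu
        have hμs := cd_le (show n ≤ M by omega) (h.hμ.contDiffOn (s := U0))
        have hgs : ContDiffOn ℝ n (fun q => rr q * g q) U0 :=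
          (rr_sm n).mul (cd_le (show n ≤ M by omega) h.hg.contDiffOn)
        have e := dw_add U0_open fE_sm u (cd_le hu (hμs.mul (h.Fsm n))) (cd_le hu hgs) hU
        have e1 := dw_mul_bound U0_open fE_sm hU n u hu hμs (h.Fsm n)
          (A := K1 * ε * ri p ^ 2) (B := Cn * ε)
          (fun v hv => (h1 ε f μ g h p hp v (by omega)).1)
          (fun v hv => ih ε f μ g hε hε0 h p hp hpt v hv)
        have e2 := (h1 ε f μ g h p hp u (by omega)).2
        have e' : dw fE u (src μ g f) p = _ := e
        rw [e']
        refine (abs_add_le _ _).trans ((add_le_add e1 e2).trans ?_)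
        have e3 : 2 ^ n * (K1 * ε * ri p ^ 2 * (Cn * ε)) = 2 ^ n * (K1 * Cn) * ε * ri p ^ 2 * ε := by
          ring
        have e4 : 2 ^ n * (K1 * Cn) * ε * ri p ^ 2 * ε ≤ 2 ^ n * (K1 * Cn) * ε * ri p ^ 2 :=
          mul_le_of_le_one_right (by positivity) hε1
        rw [e3, hK']
        linarith
      rw [dw_append, dw_some]
      have hEq : Set.EqOn (dd VX (dw fY v (Ff f)))
          (fun q => rr q * dw fE (v.map some) (src μ g f) q) Up := by
        intro q hq
        have hqU := Up_sub hq
        rw [dd_VX hqU, VD_comm_words v h.Fsm hqU, dw_congr Up_open v h.transport hq, dw_some]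
      have e0 := dw_congr Up_open (V := fE) w' hEq hUp
      have e0' : dw fE (none :: w') (dw fY v (Ff f)) p = _ := e0
      rw [e0']
      have hsr : ContDiffOn ℝ w'.length (dw fE (v.map some) (src μ g f)) U0 :=
        dw_cd U0_open fE_sm (v.map some)
          (cd_le (show w'.length + (v.map some).length ≤ M by simp; omega) h.srcM)
      have e1 := dw_mul_bound U0_open fE_sm hU w'.length w' le_rfl (rr_sm _) hsr
        (A := K2 * rr p ^ (1 : ℤ)) (B := K' * ε * ri p ^ 2)
        (fun u hu => h2 u (by omega) p hp)
        (fun u hu => by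
          rw [← dw_append]
          exact hH _ (by simp; omega))
      refine e1.trans ?_
      have hpow : (2 : ℝ) ^ w'.length ≤ 2 ^ n := pow_le_pow_right₀ (by norm_num) (by omega)
      have hrr := rr_ri hU
      rw [zpow_one]
      calc 2 ^ w'.length * (K2 * rr p * (K' * ε * ri p ^ 2))
          = 2 ^ w'.length * (K2 * K' * ε) * ri p * (rr p * ri p) := by ring
        _ = 2 ^ w'.length * (K2 * K' * ε) * ri p := by rw [hrr, mul_one]
        _ ≤ 2 ^ n * (K2 * K' * ε) * R := by
          have := ri_le hR hp
          gcongr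
        _ ≤ _ := by nlinarith [mul_pos hC0 hε]

/-- The final estimate at interior points. -/
lemma Z_bound (M : ℕ) {R : ℝ} (hR : 0 < R) : ∃ ε₀, 0 < ε₀ ∧ ∃ C, 0 < C ∧
    ∀ ε f μ g, 0 < ε → ε ≤ ε₀ →
    Hyp M R ε f μ g → ∀ p : Pt, 0 ≤ p.1 → ∀ w : List (Fin 11), w.length ≤ M →
      |dw fZ w f p| * (1 + rr p) ≤ C * ε := by
  obtain ⟨ε₀, hε₀, hE⟩ := E_bound M hR
  obtain ⟨C0, hC0, hE⟩ := hE M le_rfl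
  obtain ⟨K1, hK1, h1⟩ := conv_ZE hR M
  obtain ⟨K2, hK2, h2⟩ := Coef.g_ri.wE_bound hR M
  refine ⟨ε₀, hε₀, K1 * (2 ^ M * (K2 * C0)) * (R + 1), by positivity, ?_⟩
  intro ε f μ g hε hε0 h p hp0 w hw
  have hUp : ∀ p ∈ Up, |dw fZ w f p| * (1 + rr p) ≤ K1 * (2 ^ M * (K2 * C0)) * (R + 1) * ε := by
    intro p hp
    have hpU := Up_sub hp
    by_cases hA : p ∈ regA R
    · have hP : p ∈ PR R := ⟨le_of_lt hp.1, hA⟩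
      have hr := rr_pos hpU
      have hrr := rr_ri hpU
      have hri0 : 0 < ri p := inv_pos.mpr hr
      have e := h1 f (h.fsm U0 M) p hP (2 ^ M * (K2 * ri p * (C0 * ε))) ?_ w hw
      · have hRi := ri_le hR hP
        calc |dw fZ w f p| * (1 + rr p)
            ≤ K1 * (2 ^ M * (K2 * ri p * (C0 * ε))) * (1 + rr p) := by gcongr
          _ = K1 * (2 ^ M * (K2 * C0)) * (ri p + rr p * ri p) * ε := by ring
          _ ≤ _ := by rw [hrr]; gcongr
      · intro v hv
        have hEq : Set.EqOn f (fun q => ri q * Ff f q) U0 := by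
          intro q hq
          have := rr_ri hq
          simp only [Ff]
          linear_combination (-f q) * this
        rw [dw_congr U0_open v hEq hpU]
        refine dw_mul_bound U0_open fE_sm hpU M v hv (ri_sm M) (h.Fsm M) ?_ ?_
        · intro v hv
          have := h2 v hv p hP
          rwa [zpow_neg_one] at this
        · exact fun v hv => hE ε f μ g hε hε0 h p hP hp.1 v hv
    · have hcl : IsClosed (regA R) := by
        have hc : Continuous (fun p : Pt => rad p.2 - p.1) := by
          unfold rad; fun_prop
        exact (isClosed_le continuous_const hc).inter (isClosed_le hc continuous_const)
      have hO : IsOpen (Up ∩ (regA R)ᶜ) := Up_open.inter hcl.isOpen_compl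
      have hEq : Set.EqOn f (fun _ => 0) (Up ∩ (regA R)ᶜ) := fun q hq =>
        h.support (le_of_lt hq.1.1) (Up_sub hq.1) hq.2
      rw [dw_congr hO w hEq ⟨hp, hA⟩, dw_zero]
      simp only [abs_zero, zero_mul]
      positivity
  have hcont : Continuous (dw fZ w f) := by
    have := dw_cd isOpen_univ (fZ_sm Set.univ) w (n := 0) (h.fsm Set.univ _)
    rw [contDiffOn_univ] at this
    exact this.continuous
  have hrc : Continuous rr := by unfold rr rad; fun_prop
  have hclosed : IsClosed {p | |dw fZ w f p| * (1 + rr p) ≤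
      K1 * (2 ^ M * (K2 * C0)) * (R + 1) * ε} :=
    isClosed_le (hcont.abs.mul (continuous_const.add hrc)) continuous_const
  have hsub := hclosed.closure_subset_iff.mpr hUp
  apply hsub
  have hUpe : Up = Set.Ioi (0:ℝ) ×ˢ ({0}ᶜ : Set Spc) := by
    ext p; simp [Up, U0]
  rw [hUpe, closure_prod_eq, closure_Ioi, (dense_compl_singleton (0 : Spc)).closure_eq]
  exact ⟨hp0, trivial⟩

/-- a priori decay |Ω^J Z^I f| ≤ Cε/(1+r), |I|+|J| ≤ M, for a global
solution of (∂_t+∂_r+1/r)f = fμ + g. -/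
theorem rotation_vectorfield_derivatives_decay (M : ℕ) (R : ℝ) (hR : 0 < R) :
    ∃ ε₀ > 0, ∃ C > 0, ∀ ε : ℝ, 0 < ε → ε ≤ ε₀ →
      ∀ f μ g : Pt → ℝ, ContDiff ℝ (⊤ : ℕ∞) f → ContDiff ℝ (M : ℕ) μ → ContDiff ℝ (M : ℕ) g →
        (∀ p : Pt, 0 ≤ p.1 → p.2 ≠ 0 →
          ptd f p + prd f p + f p / rad p.2 = f p * μ p + g p) →
        (∀ x, x ∉ regA0 R → f (0, x) = 0) →
        CMBound M (fun x => f (0, x)) ε →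
        (∀ p : Pt, 0 ≤ p.1 → p ∉ regA R → g p = 0) →
        (∀ L : List Op, IsMulti L → L.length ≤ M → ∀ p : Pt, 0 ≤ p.1 →
          (1 + rad p.2) ^ 2 * |applyOps L μ p| + (1 + rad p.2) ^ 3 * |applyOps L g p| ≤ ε) →
        ∀ LJ LI : List Op, IsRotMulti LJ → IsMulti LI → LI.length + LJ.length ≤ M →
          ∀ p : Pt, 0 ≤ p.1 →
            |applyOps LJ (applyOps LI f) p| ≤ C * ε / (1 + rad p.2) := by
  obtain ⟨ε₀, hε₀, C, hC, H⟩ := Z_bound M hR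
  refine ⟨ε₀, hε₀, C, hC, ?_⟩
  intro ε hε hε0 f μ g hf hμ hg heq hinit hcm hsupp hbd LJ LI hJ hI hlen p hp
  have hyp : Hyp M R ε f μ g := by
    refine ⟨hf, hμ, hg, ?_, hinit, hcm, hsupp, ?_⟩
    · intro p hp0 hpU
      have h1 := heq p hp0 hpU
      have h2 := fd_expand ((hf.differentiable (by simp)) p) (VD p)
      have h3 : dd VD f p = ptd f p + prd f p := by
        rw [show dd VD f p = fderiv ℝ f p (VD p) from rfl, h2]
        simp [VD, prd, om, ri, rr, div_eq_mul_inv]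
      rw [h3, ← h1]
      simp [ri, rr, div_eq_mul_inv]
    · intro w hw p hp0
      have h1 := hbd (w.map mink).reverse (isMulti_words w) (by simpa using hw) p hp0
      have hcast : ((w.length : ℕ) : WithTop ℕ∞) ≤ (M : ℕ) := by exact_mod_cast hw
      rwa [applyOps_eq w (hμ.of_le hcast), applyOps_eq w (hg.of_le hcast)] at h1
  have hmulti : IsMulti (LJ ++ LI) := by
    intro Z hZ
    rcases List.mem_append.mp hZ with h | h
    exacts [rot_isMulti hJ Z h, hI Z h]
  obtain ⟨w, hw1, hw2⟩ := exists_word _ hmulti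
  have hw : w.length ≤ M := by rw [hw1, List.length_append]; omega
  have hfin := H ε f μ g hε hε0 hyp p hp w hw
  have hr : 0 < 1 + rad p.2 := by linarith [rad_nonneg p.2]
  rw [← applyOps_append, hw2, applyOps_eq w (hf.of_le (by exact_mod_cast le_top)),
    le_div_iff₀ hr]
  exact hfin
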